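/- arXiv:1910.03511 — 2 statements merged into one kernel-verified Lean document; each statement's English description precedes it below -/
import Mathlib

section
/- Suppose 𝒜 is essential. If the poset of regions PR(𝒜,B) is a lattice, then the facial weak order FW(𝒜,B) is a lattice: every pair of faces has a least upper bound and a greatest lower bound in FW(𝒜,B). -/
open scoped RealInnerProductSpace Pointwise

variable {V : Type*} [NormedAddCommGroup V] [InnerProductSpace ℝ V] [FiniteDimensional ℝ V]
  {ι : Type*} [Fintype ι]

/-- The (open) complement of the union of the hyperplanes with chosen normals `e i`. -/
def arrComplement (e : ι → V) : Set V := {v | ∀ i, ⟪e i, v⟫ ≠ 0}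

/-- A region of the arrangement: the closure of a connected component of the complement
of the union of the hyperplanes. -/
def IsRegion (e : ι → V) (R : Set V) : Prop :=
  ∃ x ∈ arrComplement e, R = closure (connectedComponentIn (arrComplement e) x)

/-- The positive closed half-space bounded by the hyperplane with normal `e i`. -/
def posHalf (e : ι → V) (i : ι) : Set V := {v | 0 ≤ ⟪e i, v⟫}

/-- The negative closed half-space bounded by the hyperplane with normal `e i`. -/
def negHalf (e : ι → V) (i : ι) : Set V := {v | ⟪e i, v⟫ ≤ 0}

/-- The separation set of two regions: the (indices of) hyperplanes such that the two
regions lie in opposite closed half-spaces. -/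
def sepSet (e : ι → V) (R R' : Set V) : Set ι :=
  {i | (R ⊆ posHalf e i ∧ R' ⊆ negHalf e i) ∨ (R ⊆ negHalf e i ∧ R' ⊆ posHalf e i)}

/-- The order of the poset of regions `PR(𝒜,B)`. -/
def PRle (e : ι → V) (B R R' : Set V) : Prop := sepSet e B R ⊆ sepSet e B R'

/-- Strict order of the poset of regions. -/
def PRlt (e : ι → V) (B R R' : Set V) : Prop := PRle e B R R' ∧ R ≠ R'

/-- Cover relation in the poset of regions. -/
def PRcover (e : ι → V) (B R R' : Set V) : Prop :=
  PRlt e B R R' ∧ ¬ ∃ U, IsRegion e U ∧ PRlt e B R U ∧ PRlt e B U R'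

/-- A face of the arrangement: an intersection of a nonempty collection of regions. -/
def IsFace (e : ι → V) (F : Set V) : Prop :=
  ∃ Rs : Set (Set V), Rs.Nonempty ∧ (∀ R ∈ Rs, IsRegion e R) ∧ F = ⋂₀ Rs

/-- `[m, M]` is the facial interval of the face `F` in the poset of regions:
the regions containing `F` are exactly those between `m` and `M`. -/
def IsFacialInterval (e : ι → V) (B F m M : Set V) : Prop :=
  IsRegion e m ∧ IsRegion e M ∧
    ∀ R, IsRegion e R → (F ⊆ R ↔ (PRle e B m R ∧ PRle e B R M))

/-- The facial weak order `FW(𝒜,B)`: `F ≤ G` iff `m_F ≤ m_G` and `M_F ≤ M_G`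
in the poset of regions. -/
def FWle (e : ι → V) (B F G : Set V) : Prop :=
  ∃ mF MF mG MG, IsFacialInterval e B F mF MF ∧ IsFacialInterval e B G mG MG ∧
    PRle e B mF mG ∧ PRle e B MF MG

/-- Strict facial weak order. -/
def FWlt (e : ι → V) (B F G : Set V) : Prop := FWle e B F G ∧ F ≠ G

/-- Cover relation in the facial weak order. -/
def FWcover (e : ι → V) (B F G : Set V) : Prop :=
  FWlt e B F G ∧ ¬ ∃ X, IsFace e X ∧ FWlt e B F X ∧ FWlt e B X G

/-- Two faces have the same maximal region `M` of their facial intervals. -/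
def SameMax (e : ι → V) (B F G : Set V) : Prop :=
  ∃ m m' M, IsFacialInterval e B F m M ∧ IsFacialInterval e B G m' M

/-- Two faces have the same minimal region `m` of their facial intervals. -/
def SameMin (e : ι → V) (B F G : Set V) : Prop :=
  ∃ m M M', IsFacialInterval e B F m M ∧ IsFacialInterval e B G m M'

/-- The dimension of a face: the dimension of its linear span. -/
noncomputable def fdim (F : Set V) : ℕ := Module.finrank ℝ (Submodule.span ℝ F)

open Classical in
/-- The covector (sign vector) of a face: the sign of `⟪e i, x⟫` for `x` in the
relative interior of the face. -/
noncomputable def covec (e : ι → V) (F : Set V) (i : ι) : SignType :=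
  if ∀ x ∈ intrinsicInterior ℝ F, 0 < ⟪e i, x⟫ then 1
  else if ∀ x ∈ intrinsicInterior ℝ F, ⟪e i, x⟫ < 0 then -1
  else 0

/-- Composition of sign vectors. -/
def scomp (f g : ι → SignType) (i : ι) : SignType := if f i ≠ 0 then f i else g i

/-- The set of roots of the arrangement: the chosen normals and their opposites. -/
def roots (e : ι → V) : Set V := Set.range e ∪ Set.range (fun i => -(e i))

/-- The root inversion set of a face. -/
def rootInv (e : ι → V) (F : Set V) : Set V :=
  {v ∈ roots e | ∃ x ∈ intrinsicInterior ℝ F, ⟪x, v⟫ ≤ 0}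

/-- `H i` is a wall of the region `R`. -/
noncomputable def IsWall (e : ι → V) (R : Set V) (i : ι) : Prop :=
  fdim ({v : V | ⟪e i, v⟫ = 0} ∩ R) = Module.finrank ℝ V - 1

/-- A region is simplicial when the normal vectors of its walls are linearly independent. -/
def IsSimplicialRegion (e : ι → V) (R : Set V) : Prop :=
  LinearIndependent ℝ (fun i : {i : ι // IsWall e R i} => e i.1)

/-- The arrangement is simplicial when all its regions are. -/
def IsSimplicial (e : ι → V) : Prop := ∀ R, IsRegion e R → IsSimplicialRegion e R

/-- The arrangement is essential when the intersection of all its hyperplanes is `{0}`. -/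
def IsEssential (e : ι → V) : Prop := (⋂ i, {v : V | ⟪e i, v⟫ = 0}) = ({0} : Set V)

/-- The poset of regions is a lattice: any two regions have a join and a meet. -/
def PRIsLattice (e : ι → V) (B : Set V) : Prop :=
  ∀ R R', IsRegion e R → IsRegion e R' →
    (∃ J, IsRegion e J ∧ PRle e B R J ∧ PRle e B R' J ∧
      ∀ U, IsRegion e U → PRle e B R U → PRle e B R' U → PRle e B J U) ∧
    (∃ M, IsRegion e M ∧ PRle e B M R ∧ PRle e B M R' ∧
      ∀ U, IsRegion e U → PRle e B U R → PRle e B U R' → PRle e B U M)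

set_option linter.unusedSectionVars false

/-! ### Covectors -/

/-- The covectors of the arrangement: the sign vectors of all points of the space. -/
def covectors (e : ι → V) : Set (ι → SignType) :=
  Set.range fun v i => SignType.sign ⟪e i, v⟫

/-- A tope is a covector without zero entries. -/
def IsTope (e : ι → V) (s : ι → SignType) : Prop := s ∈ covectors e ∧ ∀ i, s i ≠ 0

lemma SignType.eq_neg_one_or_eq_one {a : SignType} (h : a ≠ 0) : a = -1 ∨ a = 1 := by
  revert a; decide

lemma neg_mem_covectors {e : ι → V} {f : ι → SignType} (hf : f ∈ covectors e) :
    -f ∈ covectors e := by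
  obtain ⟨v, rfl⟩ := hf
  exact ⟨-v, by ext i; simp [Left.sign_neg]⟩

lemma scomp_mem_covectors {e : ι → V} {f g : ι → SignType} (hf : f ∈ covectors e)
    (hg : g ∈ covectors e) : scomp f g ∈ covectors e := by
  obtain ⟨v, rfl⟩ := hf
  obtain ⟨w, rfl⟩ := hg
  have key : ∀ i, ∀ᶠ t in nhdsWithin (0 : ℝ) (Set.Ioi 0),
      SignType.sign ⟪e i, v + t • w⟫ =
        scomp (fun i => SignType.sign ⟪e i, v⟫) (fun i => SignType.sign ⟪e i, w⟫) i := by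
    intro i
    have hc : Filter.Tendsto (fun t : ℝ => ⟪e i, v + t • w⟫) (nhdsWithin 0 (Set.Ioi 0))
        (nhds ⟪e i, v⟫) := by
      have : Continuous (fun t : ℝ => ⟪e i, v + t • w⟫) := by fun_prop
      simpa using (this.tendsto 0).mono_left nhdsWithin_le_nhds
    rcases lt_trichotomy ⟪e i, v⟫ 0 with h | h | h
    · filter_upwards [hc.eventually (gt_mem_nhds h)] with t ht
      simp [scomp, sign_neg ht, sign_neg h]
    · filter_upwards [self_mem_nhdsWithin] with t ht
      have ht : 0 < t := ht
      simp [scomp, h, inner_add_right, inner_smul_right, sign_mul, sign_pos ht]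
    · filter_upwards [hc.eventually (lt_mem_nhds h)] with t ht
      simp [scomp, sign_pos ht, sign_pos h]
  obtain ⟨t, ht⟩ := (Filter.eventually_all.2 key).exists
  exact ⟨v + t • w, funext ht⟩

lemma IsTope.scomp {e : ι → V} {f g : ι → SignType} (hf : f ∈ covectors e)
    (hg : IsTope e g) : IsTope e (scomp f g) := by
  refine ⟨scomp_mem_covectors hf hg.1, fun i => ?_⟩
  have := hg.2 i
  unfold _root_.scomp
  split_ifs <;> assumption

lemma IsTope.neg {e : ι → V} {f : ι → SignType} (hf : IsTope e f) : IsTope e (-f) :=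
  ⟨neg_mem_covectors hf.1, fun i => by simpa using hf.2 i⟩

/-- Moving from a covector `f` towards `g`, one meets a first covector `w ≠ f`, obtained from `f`
by turning into zeros some of the entries where `f` and `g` differ. -/
lemma exists_first_crossing {e : ι → V} {f g : ι → SignType} (hf : f ∈ covectors e)
    (hg : g ∈ covectors e) (h0 : ∀ i, f i = 0 → g i = 0) (hne : f ≠ g) :
    ∃ w ∈ covectors e, w ≠ f ∧ ∀ i, w i = f i ∨ (w i = 0 ∧ g i ≠ f i) := by
  classical
  obtain ⟨v, rfl⟩ := hf
  obtain ⟨u, rfl⟩ := hg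
  simp only [sign_eq_zero_iff] at h0
  let D : Finset ι := Finset.univ.filter fun i => SignType.sign ⟪e i, v⟫ ≠ SignType.sign ⟪e i, u⟫
  have hD : D.Nonempty := by
    obtain ⟨i, hi⟩ := Function.ne_iff.1 hne
    exact ⟨i, by simpa [D] using hi⟩
  let τ : ι → ℝ := fun i => ⟪e i, v⟫ / (⟪e i, v⟫ - ⟪e i, u⟫)
  obtain ⟨k, hkD, hk⟩ := D.exists_min_image τ hD
  have hcomb : ∀ i, ⟪e i, (1 - τ k) • v + τ k • u⟫ = (1 - τ k) * ⟪e i, v⟫ + τ k * ⟪e i, u⟫ := by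
    intro i; simp [inner_add_right, inner_smul_right]
  have opp : ∀ i ∈ D, (0 < ⟪e i, v⟫ ∧ ⟪e i, u⟫ ≤ 0) ∨ (⟪e i, v⟫ < 0 ∧ 0 ≤ ⟪e i, u⟫) := by
    intro i hi
    have hi' : SignType.sign ⟪e i, v⟫ ≠ SignType.sign ⟪e i, u⟫ := by simpa [D] using hi
    rcases lt_trichotomy ⟪e i, v⟫ 0 with h | h | h
    · right
      refine ⟨h, not_lt.1 fun h' => hi' ?_⟩
      rw [sign_neg h, sign_neg h']
    · exact absurd (by rw [h, h0 i h]) hi'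
    · left
      refine ⟨h, not_lt.1 fun h' => hi' ?_⟩
      rw [sign_pos h, sign_pos h']
  have hτ0 : 0 < τ k ∧ τ k ≤ 1 := by
    rcases opp k hkD with ⟨h1, h2⟩ | ⟨h1, h2⟩
    · have : 0 < ⟪e k, v⟫ - ⟪e k, u⟫ := by linarith
      exact ⟨div_pos h1 this, (div_le_one this).2 (by linarith)⟩
    · have : ⟪e k, v⟫ - ⟪e k, u⟫ < 0 := by linarith
      exact ⟨div_pos_of_neg_of_neg h1 this, (div_le_one_of_neg this).2 (by linarith)⟩
  refine ⟨_, ⟨(1 - τ k) • v + τ k • u, rfl⟩, ?_, ?_⟩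
  · refine Function.ne_iff.2 ⟨k, ?_⟩
    have hz : ⟪e k, (1 - τ k) • v + τ k • u⟫ = 0 := by
      rw [hcomb]
      have : ⟪e k, v⟫ - ⟪e k, u⟫ ≠ 0 := by
        rcases opp k hkD with ⟨h1, h2⟩ | ⟨h1, h2⟩ <;> intro h <;> linarith
      simp only [τ]; field_simp; ring
    have hv : ⟪e k, v⟫ ≠ 0 := by
      rcases opp k hkD with ⟨h1, h2⟩ | ⟨h1, h2⟩ <;> intro h <;> linarith
    simp only [hz, sign_zero]
    exact fun h => hv (sign_eq_zero_iff.1 h.symm)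
  · intro i
    simp only [hcomb]
    by_cases hi : i ∈ D
    · have hne' : SignType.sign ⟪e i, u⟫ ≠ SignType.sign ⟪e i, v⟫ := by
        simpa [D, eq_comm] using hi
      have hle := hk i hi
      rcases opp i hi with ⟨h1, h2⟩ | ⟨h1, h2⟩
      · have hd : 0 < ⟪e i, v⟫ - ⟪e i, u⟫ := by linarith
        have := (le_div_iff₀ hd).1 hle
        rcases (show 0 ≤ (1 - τ k) * ⟪e i, v⟫ + τ k * ⟪e i, u⟫ by linarith).eq_or_lt with h | h
        · right; exact ⟨by rw [← h, sign_zero], hne'⟩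
        · left; rw [sign_pos h, sign_pos h1]
      · have hd : ⟪e i, v⟫ - ⟪e i, u⟫ < 0 := by linarith
        have := (le_div_iff_of_neg hd).1 hle
        rcases (show (1 - τ k) * ⟪e i, v⟫ + τ k * ⟪e i, u⟫ ≤ 0 by linarith).eq_or_lt with h | h
        · right; exact ⟨by rw [h, sign_zero], hne'⟩
        · left; rw [sign_neg h, sign_neg h1]
    · left
      have heq : SignType.sign ⟪e i, v⟫ = SignType.sign ⟪e i, u⟫ := by
        by_contra h; exact hi (by simpa [D] using h)
      rcases lt_trichotomy ⟪e i, v⟫ 0 with h | h | h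
      · have h' : ⟪e i, u⟫ < 0 := sign_eq_neg_one_iff.1 (heq ▸ sign_neg h)
        rw [sign_neg h]; apply sign_neg
        nlinarith [hτ0.1, hτ0.2, mul_neg_of_pos_of_neg hτ0.1 h']
      · rw [h, h0 i h]; simp
      · have h' : 0 < ⟪e i, u⟫ := sign_eq_one_iff.1 (heq ▸ sign_pos h)
        rw [sign_pos h]; apply sign_pos
        nlinarith [hτ0.1, hτ0.2, mul_pos hτ0.1 h']

/-- A convex set realizing all strict sign patterns of finitely many linear forms also realizes
all patterns in which some of the signs are replaced by zero. -/
lemma Convex.exists_vanishing_of_forall_pattern [DecidableEq ι] {e : ι → V} {C : Set V}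
    (hC : Convex ℝ C)
    (K : Finset ι)
    (h : ∀ J : Finset ι, ∃ v ∈ C, ∀ k ∈ K,
      (k ∈ J → ⟪e k, v⟫ < 0) ∧ (k ∉ J → 0 < ⟪e k, v⟫)) (Z : Finset ι) (hZ : Z ⊆ K) :
    ∀ J : Finset ι, ∃ v ∈ C, ∀ k ∈ K, (k ∈ Z → ⟪e k, v⟫ = 0) ∧
      (k ∉ Z → k ∈ J → ⟪e k, v⟫ < 0) ∧ (k ∉ Z → k ∉ J → 0 < ⟪e k, v⟫) := by
  induction Z using Finset.induction_on with
  | empty => simpa using h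
  | insert j Z hj ih =>
    intro J
    have ih := ih fun x hx => hZ (Finset.mem_insert_of_mem hx)
    have hjK : j ∈ K := hZ (Finset.mem_insert_self j Z)
    obtain ⟨v, hv, hv'⟩ := ih (insert j J)
    obtain ⟨w, hw, hw'⟩ := ih (J.erase j)
    have h1 : ⟪e j, v⟫ < 0 := (hv' j hjK).2.1 hj (Finset.mem_insert_self j J)
    have h2 : 0 < ⟪e j, w⟫ := (hw' j hjK).2.2 hj (Finset.notMem_erase j J)
    have hd : 0 < ⟪e j, w⟫ - ⟪e j, v⟫ := by linarith
    have ha : 0 < ⟪e j, w⟫ / (⟪e j, w⟫ - ⟪e j, v⟫) := div_pos h2 hd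
    have hb : 0 < -⟪e j, v⟫ / (⟪e j, w⟫ - ⟪e j, v⟫) := div_pos (by linarith) hd
    refine ⟨_, hC hv hw ha.le hb.le (by field_simp; ring), fun k hk => ?_⟩
    simp only [inner_add_right, inner_smul_right, Finset.mem_insert, not_or]
    refine ⟨?_, ?_, ?_⟩
    · rintro (rfl | hkZ)
      · field_simp; ring
      · rw [(hv' k hk).1 hkZ, (hw' k hk).1 hkZ]; simp
    · rintro ⟨hkj, hkZ⟩ hkJ
      have := (hv' k hk).2.1 hkZ (Finset.mem_insert_of_mem hkJ)
      have := (hw' k hk).2.1 hkZ (Finset.mem_erase.2 ⟨hkj, hkJ⟩)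
      have := mul_neg_of_pos_of_neg ha ‹⟪e k, v⟫ < 0›
      have := mul_neg_of_pos_of_neg hb ‹⟪e k, w⟫ < 0›
      linarith
    · rintro ⟨hkj, hkZ⟩ hkJ
      have := (hv' k hk).2.2 hkZ (by simp [hkj, hkJ])
      have := (hw' k hk).2.2 hkZ (by simp [hkJ])
      have := mul_pos ha ‹0 < ⟪e k, v⟫›
      have := mul_pos hb ‹0 < ⟪e k, w⟫›
      linarith

/-! ### Regions above a given one -/

/-- `i` is principal for the tope `m` if there is a least region (for the order of `PR(𝒜,B)`)
above `m` on the negative side of the hyperplane `i`. -/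
def Principal (e : ι → V) (m : ι → SignType) (i : ι) : Prop :=
  ∃ x, IsTope e x ∧ x ≤ m ∧ x i = -1 ∧ ∀ R, IsTope e R → R ≤ m → R i = -1 → R ≤ x

lemma exists_principal {e : ι → V} {m Q : ι → SignType} (hm : IsTope e m) (hQ : IsTope e Q)
    (hQm : Q ≤ m) (hne : Q ≠ m) : ∃ i, m i = 1 ∧ Q i = -1 ∧ Principal e m i := by
  obtain ⟨Q', -, hQ'⟩ := (Set.toFinite {P | IsTope e P ∧ Q ≤ P ∧ P ≤ m ∧ P ≠ m}).exists_le_maximal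
    (a := Q) ⟨hQ, le_rfl, hQm, hne⟩
  obtain ⟨hT, hQQ', hQ'm, hne'⟩ := hQ'.prop
  obtain ⟨w, hw, hwm, hw'⟩ := exists_first_crossing hm.1 hT.1
    (fun i hi => absurd hi (hm.2 i)) hne'.symm
  have hflip : ∀ i, w i = 0 → m i = 1 ∧ Q' i = -1 := by
    intro i hi
    have h1 := hm.2 i; have h2 := hT.2 i; have h3 : Q' i ≤ m i := hQ'm i
    have h4 : Q' i ≠ m i := by
      rcases hw' i with h | h
      · exact absurd (h ▸ hi) h1
      · exact h.2
    revert h1 h2 h3 h4; generalize m i = a; generalize Q' i = b; revert a b; decide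
  have hkeep : ∀ i, w i ≠ 0 → w i = m i := fun i hi =>
    (hw' i).resolve_right fun h => hi h.1
  obtain ⟨i, hi⟩ := Function.ne_iff.1 hwm
  have hi0 : w i = 0 := by by_contra h; exact hi (hkeep i h)
  refine ⟨i, (hflip i hi0).1, ?_, Q', hT, hQ'm, (hflip i hi0).2, fun R hR hRm hRi => ?_⟩
  · have h1 : Q i ≤ Q' i := hQQ' i; have h2 := hQ.2 i
    rw [(hflip i hi0).2] at h1
    revert h1 h2; generalize Q i = a; revert a; decide
  have hP : IsTope e (scomp w R) := IsTope.scomp hw hR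
  have hPm : scomp w R ≤ m := by
    intro k
    unfold scomp
    split_ifs with h
    · exact (hkeep k h).le
    · exact hRm k
  have hQ'P : Q' ≤ scomp w R := by
    intro k
    change Q' k ≤ scomp w R k
    unfold scomp
    split_ifs with h
    · exact (hQ'm k).trans (hkeep k h).ge
    · rw [(hflip k (not_not.1 h)).2]; generalize R k = a; revert a; decide
  have hPne : scomp w R ≠ m := by
    intro h
    have := congrFun h i
    simp [scomp, hi0, hRi, (hflip i hi0).1] at this
  have hPQ' := hQ'.le_of_ge ⟨hP, hQQ'.trans hQ'P, hPm, hPne⟩ hQ'P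
  intro k
  have := hPQ' k
  by_cases h : w k = 0
  · simpa [scomp, h] using this
  · simp only [scomp, ne_eq, h, not_false_eq_true, if_true] at this
    exact (hRm k).trans ((hkeep k h).ge.trans this)

/-- A region above the bottom region of the facial interval of `x`, separated from it by all
principal hyperplanes containing `x`, is above the top region of that interval. -/
lemma le_scomp_neg_one_of_principal {e : ι → V} {x R : ι → SignType} (hx : x ∈ covectors e)
    (h1 : (1 : ι → SignType) ∈ covectors e) (hR : IsTope e R) (hRm : R ≤ scomp x 1)
    (hK : ∀ i, x i = 0 → Principal e (scomp x 1) i → R i = -1) : R ≤ scomp x (-1) := by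
  have hm : IsTope e (scomp x 1) := IsTope.scomp hx ⟨h1, by simp⟩
  by_contra hcon
  obtain ⟨i, hi⟩ := not_forall.1 hcon
  change ¬ R i ≤ scomp x (-1) i at hi
  have hxi : x i = 0 := by
    by_contra h
    have := hRm i
    simp only [scomp, ne_eq, h, not_false_eq_true, if_true] at this hi
    exact hi this
  have hRi : R i = 1 := by
    have := hR.2 i
    simp only [scomp, hxi, ne_eq, not_true, if_false, Pi.neg_apply, Pi.one_apply] at hi
    revert this hi; generalize R i = a; revert a; decide
  obtain ⟨k, hk1, hk2, hk3⟩ := exists_principal hm (IsTope.scomp hx hR.neg)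
    (fun k => by
      change scomp x (-R) k ≤ scomp x 1 k
      unfold scomp
      split_ifs
      · exact le_rfl
      · simp only [Pi.neg_apply, Pi.one_apply]; generalize R k = a; revert a; decide)
    (fun h => by
      have := congrFun h i
      simp [scomp, hxi, hRi] at this)
  have hxk : x k = 0 := by
    by_contra h
    simp only [scomp, ne_eq, h, not_false_eq_true, if_true] at hk1 hk2
    rw [hk1] at hk2; exact absurd hk2 (by decide)
  have hRk := hK k hxk hk3
  simp [scomp, hxk, hRk] at hk2

/-- The lattice property of the poset of regions, in terms of topes (the order of `PR(𝒜,B)` is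
the reverse of the componentwise order). -/
def TopesHaveInf (e : ι → V) : Prop :=
  ∀ s t, IsTope e s → IsTope e t → ∃ j, IsTope e j ∧ IsGreatest {u | IsTope e u ∧ u ≤ s ∧ u ≤ t} j

lemma exists_greatest_covector {e : ι → V} (hlat : TopesHaveInf e) {m M y : ι → SignType}
    (hm : IsTope e m) (hM : IsTope e M) (hMm : M ≤ m) (K : Finset ι)
    (hprin : ∀ k ∈ K, Principal e m k) (hKM : ∀ k ∈ K, M k = -1)
    (hleast : ∀ R, IsTope e R → R ≤ m → (∀ k ∈ K, R k = -1) → R ≤ M)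
    (hy : y ∈ covectors e) (hyM : ∀ i, y i = -1 → M i = -1) :
    ∃ u, IsGreatest {u | u ∈ covectors e ∧ (∀ i, M i = -1 → u i ≤ 0) ∧
      (∀ i, m i = -1 → u i = -1) ∧ (∀ i, y i = -1 → u i = -1)} u := by
  classical
  obtain ⟨K', hK'K, hK'⟩ := exists_minimal_le_of_wellFoundedLT
    (fun K' : Finset ι => ∀ R, IsTope e R → R ≤ m → (∀ k ∈ K', R k = -1) → R ≤ M) K hleast
  have hmin : ∀ k ∈ K', ∃ R, IsTope e R ∧ R ≤ m ∧ (∀ l ∈ K', l ≠ k → R l = -1) ∧ R k = 1 := by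
    intro k hk
    have : ¬ ∀ R, IsTope e R → R ≤ m → (∀ l ∈ K'.erase k, R l = -1) → R ≤ M := fun h =>
      Finset.notMem_erase k K' (hK'.le_of_le h (Finset.erase_subset k K') hk)
    push Not at this
    obtain ⟨R, hR, hRm, hRK, hRM⟩ := this
    refine ⟨R, hR, hRm, fun l hl hlk => hRK l (Finset.mem_erase.2 ⟨hlk, hl⟩), ?_⟩
    refine (SignType.eq_neg_one_or_eq_one (hR.2 k)).resolve_left fun hk1 => hRM ?_
    refine hK'.prop R hR hRm fun l hl => ?_
    by_cases h : l = k
    · rw [h, hk1]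
    · exact hRK l (Finset.mem_erase.2 ⟨h, hl⟩)
  have hjoin : ∀ J : Finset ι, J ⊆ K' → ∃ P, IsTope e P ∧ P ≤ m ∧ (∀ k ∈ J, P k = -1) ∧
      ∀ R, IsTope e R → R ≤ m → (∀ k ∈ J, R k = -1) → R ≤ P := by
    intro J
    induction J using Finset.induction_on with
    | empty => exact fun _ => ⟨m, hm, le_rfl, by simp, fun R _ h _ => h⟩
    | insert j J hj ih =>
      intro hJ
      obtain ⟨P, hP, hPm, hPJ, hPl⟩ := ih fun x hx => hJ (Finset.mem_insert_of_mem hx)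
      obtain ⟨x, hx, hxm, hxj, hxl⟩ := hprin j (hK'K (hJ (Finset.mem_insert_self j J)))
      obtain ⟨S, hS, ⟨-, hSP, hSx⟩, hSl⟩ := hlat P x hP hx
      have aux : ∀ a b : SignType, a ≤ b → b = -1 → a = -1 := by decide
      refine ⟨S, hS, hSP.trans hPm, fun k hk => ?_, fun R hR hRm hRJ => hSl ⟨hR, ?_, ?_⟩⟩
      · rcases Finset.mem_insert.1 hk with rfl | hk
        · exact aux _ _ (hSx k) hxj
        · exact aux _ _ (hSP k) (hPJ k hk)
      · exact hPl R hR hRm fun k hk => hRJ k (Finset.mem_insert_of_mem hk)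
      · exact hxl R hR hRm (hRJ j (Finset.mem_insert_self j J))
  let C : Set V := {v | ∀ i, (m i = -1 → ⟪e i, v⟫ < 0) ∧ (M i = 1 → 0 < ⟪e i, v⟫)}
  have hC : Convex ℝ C := by
    intro v hv w hw a b ha hb hab i
    simp only [inner_add_right, inner_smul_right]
    constructor
    · intro h
      have h1 := (hv i).1 h
      have h2 := (hw i).1 h
      rcases ha.eq_or_lt with rfl | ha
      · simp at hab; simp [hab, h2]
      · nlinarith [mul_neg_of_pos_of_neg ha h1, mul_nonneg hb (neg_nonneg.2 h2.le)]
    · intro h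
      have h1 := (hv i).2 h
      have h2 := (hw i).2 h
      rcases ha.eq_or_lt with rfl | ha
      · simp at hab; simp [hab, h2]
      · nlinarith [mul_pos ha h1, mul_nonneg hb h2.le]
  have hpat : ∀ J : Finset ι, ∃ v ∈ C, ∀ k ∈ K',
      (k ∈ J → ⟪e k, v⟫ < 0) ∧ (k ∉ J → 0 < ⟪e k, v⟫) := by
    intro J
    obtain ⟨P, ⟨⟨v, rfl⟩, hP⟩, hPm, hPJ, hPl⟩ := hjoin (J ∩ K') Finset.inter_subset_right
    have hMP := hPl M hM hMm fun k hk => hKM k (hK'K (Finset.mem_inter.1 hk).2)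
    refine ⟨v, fun i => ⟨fun h => ?_, fun h => ?_⟩, fun k hk => ⟨fun hkJ => ?_, fun hkJ => ?_⟩⟩
    · have := hPm i
      rw [h] at this
      exact sign_eq_neg_one_iff.1 (le_antisymm this (SignType.neg_one_le _))
    · have := hMP i
      rw [h] at this
      exact sign_eq_one_iff.1 (le_antisymm (SignType.le_one _) this)
    · exact sign_eq_neg_one_iff.1 (hPJ k (Finset.mem_inter.2 ⟨hkJ, hk⟩))
    · obtain ⟨R, hR, hRm, hRK, hRk⟩ := hmin k hk
      have := hPl R hR hRm (fun l hl => hRK l (Finset.mem_inter.1 hl).2 fun h =>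
        hkJ (h ▸ (Finset.mem_inter.1 hl).1)) k
      rw [hRk] at this
      exact sign_eq_one_iff.1 (le_antisymm (SignType.le_one _) this)
  obtain ⟨v, hvC, hv⟩ := Convex.exists_vanishing_of_forall_pattern hC K' hpat
    (K'.filter fun k => y k ≠ -1) (Finset.filter_subset _ _) K'
  obtain ⟨u, hu⟩ : ∃ u : ι → SignType, u = fun i => SignType.sign ⟪e i, v⟫ := ⟨_, rfl⟩
  have huL : u ∈ covectors e := ⟨v, hu.symm⟩
  have hum : ∀ i, m i = -1 → u i = -1 := fun i hi => by
    rw [hu]; exact sign_neg ((hvC i).1 hi)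
  have huM : ∀ i, M i = 1 → u i = 1 := fun i hi => by
    rw [hu]; exact sign_pos ((hvC i).2 hi)
  have huJ : ∀ k ∈ K', y k = -1 → u k = -1 := fun k hk hyk => by
    rw [hu]; exact sign_neg ((hv k hk).2.1 (by simp [hyk]) hk)
  have huZ : ∀ k ∈ K', y k ≠ -1 → u k = 0 := fun k hk hyk => by
    rw [hu]; simpa using (hv k hk).1 (by simp [hyk, hk])
  have hMK' : ∀ k ∈ K', M k = -1 := fun k hk => hKM k (hK'K hk)
  have hle : ∀ s : ι → SignType, IsTope e s → (∀ i, m i = -1 → s i = -1) → s ≤ m := by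
    intro s hs h i
    have h1 := h i; have h2 := hm.2 i; have h3 := hs.2 i
    change s i ≤ m i
    revert h1 h2 h3; generalize s i = a; generalize m i = b; revert a b; decide
  have hneg : ∀ s : ι → SignType, IsTope e s → (∀ i, m i = -1 → s i = -1) →
      (∀ k ∈ K', s k = -1) → ∀ i, M i = -1 → s i = -1 := by
    intro s hs h hsK i hi
    have := hK'.prop s hs (hle s hs h) hsK i
    rw [hi] at this
    exact le_antisymm this (SignType.neg_one_le _)
  have huM' : ∀ i, M i = -1 → u i ≤ 0 := by
    intro i hi
    have := hneg (scomp u M) (IsTope.scomp huL hM) (fun i hi => by simp [scomp, hum i hi])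
      (fun k hk => by
        by_cases hyk : y k = -1
        · simp [scomp, huJ k hk hyk]
        · simp [scomp, huZ k hk hyk, hMK' k hk]) i hi
    revert this; unfold scomp; rw [hi]; generalize u i = a; revert a; decide
  refine ⟨u, ⟨huL, huM', hum, fun i hyi => ?_⟩, fun u' ⟨hu'L, hu'M, hu'm, hu'y⟩ i => ?_⟩
  · by_contra hne
    have h0 : u i = 0 := by
      have := huM' i (hyM i hyi)
      revert this hne; generalize u i = a; revert a; decide
    have := hneg (scomp u (scomp (-y) M))
      (IsTope.scomp huL (IsTope.scomp (neg_mem_covectors hy) hM))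
      (fun i hi => by simp [scomp, hum i hi])
      (fun k hk => by
        by_cases hyk : y k = -1
        · simp [scomp, huJ k hk hyk]
        · have h1 := huZ k hk hyk; have h2 := hMK' k hk
          simp only [scomp, h1, h2, Pi.neg_apply]
          revert hyk; generalize y k = a; revert a; decide) i (hyM i hyi)
    simp [scomp, h0, hyi] at this
  · rcases (SignType.eq_neg_one_or_eq_one (hM.2 i)) with hMi | hMi
    · have h1 := huM' i hMi; have h2 := hu'M i hMi
      have h3 : u i = -1 → u' i ≠ 0 := by
        intro hui h0
        have := hneg (scomp u' (scomp (-u) M))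
          (IsTope.scomp hu'L (IsTope.scomp (neg_mem_covectors huL) hM))
          (fun i hi => by simp [scomp, hu'm i hi])
          (fun k hk => by
            by_cases hyk : y k = -1
            · simp [scomp, hu'y k hyk]
            · have h1 := huZ k hk hyk; have h2 := hMK' k hk; have h3 := hu'M k h2
              simp only [scomp, h1, h2, Pi.neg_apply]
              revert h3; generalize u' k = a; revert a; decide) i hMi
        simp [scomp, h0, hui] at this
      change u' i ≤ u i
      revert h1 h2 h3; generalize u' i = a; generalize u i = b; revert a b; decide
    · exact (SignType.le_one _).trans (huM i hMi).ge

/-! ### Greatest lower bounds of covectors -/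

/-- The greatest covector subject to the sign conditions that describe the common lower bounds of
`x` and `x'`, whose facial intervals have the same bottom region, and of `y`; here `M` is the join
(in the poset of regions) of the top regions of the facial intervals of `x` and `x'`. -/
lemma exists_greatest_of_facets {e : ι → V} (hlat : TopesHaveInf e)
    (h1 : (1 : ι → SignType) ∈ covectors e) {x x' y M : ι → SignType} (hx : x ∈ covectors e)
    (hx' : x' ∈ covectors e) (hy : y ∈ covectors e) (hxx' : scomp x' 1 = scomp x 1)
    (hM : IsTope e M)
    (hMx : IsGreatest {u | IsTope e u ∧ u ≤ scomp x (-1) ∧ u ≤ scomp x' (-1)} M)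
    (hyM : ∀ i, y i = -1 → M i = -1) :
    ∃ u, IsGreatest {u | u ∈ covectors e ∧ (∀ i, M i = -1 → u i ≤ 0) ∧
      (∀ i, scomp x 1 i = -1 → u i = -1) ∧ (∀ i, y i = -1 → u i = -1)} u := by
  classical
  have hm : IsTope e (scomp x 1) := IsTope.scomp hx ⟨h1, by simp⟩
  have hle : scomp x (-1) ≤ scomp x 1 := fun i => by
    change scomp x (-1) i ≤ scomp x 1 i
    unfold scomp
    split_ifs
    · exact le_rfl
    · exact SignType.le_one _
  refine exists_greatest_covector hlat hm hM (hMx.1.2.1.trans hle)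
    (Finset.univ.filter fun i => (x i = 0 ∨ x' i = 0) ∧ Principal e (scomp x 1) i)
    (by simp) ?_ ?_ hy hyM
  · intro k hk
    have h1 : M k ≤ scomp x (-1) k := hMx.1.2.1 k
    have h2 : M k ≤ scomp x' (-1) k := hMx.1.2.2 k
    rcases (Finset.mem_filter.1 hk).2.1 with h | h
    · refine le_antisymm ?_ (SignType.neg_one_le _)
      simpa [scomp, h] using h1
    · refine le_antisymm ?_ (SignType.neg_one_le _)
      simpa [scomp, h] using h2
  · intro R hR hRm hRK
    refine hMx.2 ⟨hR, ?_, ?_⟩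
    · exact le_scomp_neg_one_of_principal hx h1 hR hRm fun i hi hp =>
        hRK i (by simp [hi, hp])
    · exact le_scomp_neg_one_of_principal hx' h1 hR (hxx' ▸ hRm) fun i hi hp =>
        hRK i (by simp [hi, hxx' ▸ hp])

lemma exists_step {e : ι → V} {z f : ι → SignType} (hz : z ∈ covectors e) (hf : f ∈ covectors e)
    (hfz : f ≤ z) (hne : f ≠ z) : ∃ x ∈ covectors e, f ≤ x ∧ x < z ∧
      ((∀ i, z i ≠ 0 → x i = z i) ∨ (∀ i, x i ≠ 0 → x i = z i)) := by
  by_cases h : scomp z f = z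
  · have h0 : ∀ i, z i = 0 → f i = 0 := fun i hi => by
      have := congrFun h i
      simpa [scomp, hi] using this
    obtain ⟨x, hx, hxz, hx'⟩ := exists_first_crossing hz hf h0 hne.symm
    have key : ∀ i, f i ≤ x i ∧ x i ≤ z i := by
      intro i
      have h1 : f i ≤ z i := hfz i
      have h2 := hx' i; have h3 := h0 i
      revert h1 h2 h3; generalize f i = a; generalize x i = b; generalize z i = c
      revert a b c; decide
    exact ⟨x, hx, fun i => (key i).1, lt_of_le_of_ne (fun i => (key i).2) hxz,
      .inr fun i hi => (hx' i).resolve_right fun h => hi h.1⟩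
  · refine ⟨scomp z f, scomp_mem_covectors hz hf, fun i => ?_,
      lt_of_le_of_ne (fun i => ?_) h, .inl fun i hi => by simp [scomp, hi]⟩
    · change f i ≤ scomp z f i
      unfold scomp
      split_ifs
      exacts [hfz i, le_rfl]
    · change scomp z f i ≤ z i
      unfold scomp
      split_ifs
      exacts [le_rfl, hfz i]

/-- The common lower bounds of `f` and `g` among covectors have a greatest element. -/
def HaveInf (e : ι → V) (f g : ι → SignType) : Prop :=
  ∃ j, IsGreatest {u | u ∈ covectors e ∧ u ≤ f ∧ u ≤ g} j

lemma HaveInf.symm {e : ι → V} {f g : ι → SignType} (h : HaveInf e f g) : HaveInf e g f := by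
  simpa only [HaveInf, and_comm (a := _ ≤ f)] using h

lemma haveInf_of_facet_of_coface {e : ι → V} (hlat : TopesHaveInf e)
    (h1 : (1 : ι → SignType) ∈ covectors e) {x y z : ι → SignType} (hx : x ∈ covectors e)
    (hy : y ∈ covectors e) (hxd : ∀ i, x i ≠ 0 → x i = z i)
    (hyu : ∀ i, z i ≠ 0 → y i = z i) (hxz : x ≤ z) : HaveInf e x y := by
  have hM : IsTope e (scomp x (-1)) := IsTope.scomp hx (IsTope.neg ⟨h1, by simp⟩)
  obtain ⟨u, ⟨hu, hu1, hu2, hu3⟩, hul⟩ := exists_greatest_of_facets hlat h1 hx hx hy rfl hM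
    ⟨⟨hM, le_rfl, le_rfl⟩, fun v hv => hv.2.1⟩ (fun i hi => by
      have h1 : x i ≤ z i := hxz i
      have h2 := hxd i; have h3 := hyu i
      simp only [scomp, Pi.neg_apply, Pi.one_apply]
      revert hi h1 h2 h3; generalize x i = a; generalize y i = b; generalize z i = c
      revert a b c; decide)
  refine ⟨u, ⟨hu, fun i => ?_, fun i => ?_⟩, fun v ⟨hv, hvx, hvy⟩ => hul ⟨hv, ?_, ?_, ?_⟩⟩
  · change u i ≤ x i
    have h1 := hu1 i; have h2 := hu2 i
    simp only [scomp, Pi.neg_apply, Pi.one_apply] at h1 h2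
    revert h1 h2; generalize u i = a; generalize x i = b; revert a b; decide
  · change u i ≤ y i
    have h1 := hu1 i; have h2 := hu3 i
    have h3 : y i = 0 → x i = 0 := by
      have h3 := hxd i; have h4 := hyu i
      revert h3 h4; generalize x i = a; generalize y i = b; generalize z i = c
      revert a b c; decide
    simp only [scomp, Pi.neg_apply, Pi.one_apply] at h1
    revert h1 h2 h3; generalize u i = a; generalize x i = b; generalize y i = c
    revert a b c; decide
  · intro i hi
    have h1 : v i ≤ x i := hvx i
    simp only [scomp, Pi.neg_apply, Pi.one_apply] at hi
    revert h1 hi; generalize v i = a; generalize x i = b; revert a b; decide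
  · intro i hi
    have h1 : v i ≤ x i := hvx i
    simp only [scomp, Pi.one_apply] at hi
    revert h1 hi; generalize v i = a; generalize x i = b; revert a b; decide
  · intro i hi
    have h1 : v i ≤ y i := hvy i
    rw [hi] at h1
    exact le_antisymm h1 (SignType.neg_one_le _)

lemma haveInf_of_facets {e : ι → V} (hlat : TopesHaveInf e)
    (h1 : (1 : ι → SignType) ∈ covectors e) {x y z : ι → SignType} (hx : x ∈ covectors e)
    (hy : y ∈ covectors e) (hxz : x ≤ z) (hyz : y ≤ z) (hxd : ∀ i, x i ≠ 0 → x i = z i)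
    (hyd : ∀ i, y i ≠ 0 → y i = z i) : HaveInf e x y := by
  have hn : IsTope e (-1) := IsTope.neg ⟨h1, by simp⟩
  have htop : ∀ w : ι → SignType, w ≤ z → (∀ i, w i ≠ 0 → w i = z i) →
      scomp w 1 = scomp z 1 := by
    intro w hw hwd
    ext i
    have h1 : w i ≤ z i := hw i
    have h2 := hwd i
    simp only [scomp, Pi.one_apply]
    revert h1 h2; generalize w i = a; generalize z i = b; revert a b; decide
  have hxy := (htop y hyz hyd).trans (htop x hxz hxd).symm
  obtain ⟨M, hM, hMg⟩ := hlat _ _ (IsTope.scomp hx hn) (IsTope.scomp hy hn)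
  have hm : IsTope e (scomp x 1) := IsTope.scomp hx ⟨h1, by simp⟩
  obtain ⟨u, ⟨hu, hu1, hu2, hu3⟩, hul⟩ := exists_greatest_of_facets hlat h1 hx hy hx hxy hM hMg
    (fun i hi => by
      have h1 : M i ≤ scomp x (-1) i := hMg.1.2.1 i
      simp only [scomp, hi] at h1
      exact le_antisymm h1 (SignType.neg_one_le _))
  have hlow : ∀ w : ι → SignType, M ≤ scomp w (-1) → scomp w 1 = scomp x 1 → u ≤ w := by
    intro w hMw hwx i
    have h1 := hu1 i; have h2 := hu2 i
    have h3 : M i ≤ scomp w (-1) i := hMw i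
    rw [← hwx] at h2
    simp only [scomp, Pi.neg_apply, Pi.one_apply] at h2 h3
    change u i ≤ w i
    revert h1 h2 h3; generalize u i = a; generalize w i = b; generalize M i = c
    revert a b c; decide
  refine ⟨u, ⟨hu, hlow x hMg.1.2.1 rfl, hlow y hMg.1.2.2 hxy⟩,
    fun v ⟨hv, hvx, hvy⟩ => hul ⟨hv, ?_, ?_, ?_⟩⟩
  · have hmono : ∀ w : ι → SignType, v ≤ w → scomp v (-1) ≤ scomp w (-1) := by
      intro w hw i
      have h1 : v i ≤ w i := hw i
      change scomp v (-1) i ≤ scomp w (-1) i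
      simp only [scomp, Pi.neg_apply, Pi.one_apply]
      revert h1; generalize v i = a; generalize w i = b; revert a b; decide
    have hvM := hMg.2 ⟨IsTope.scomp hv hn, hmono x hvx, hmono y hvy⟩
    intro i hi
    have h1 : scomp v (-1) i ≤ M i := hvM i
    simp only [scomp, hi, Pi.neg_apply, Pi.one_apply] at h1
    revert h1; generalize v i = a; revert a; decide
  · intro i hi
    have h1 : v i ≤ x i := hvx i
    simp only [scomp, Pi.one_apply] at hi
    revert h1 hi; generalize v i = a; generalize x i = b; revert a b; decide
  · intro i hi
    have h1 : v i ≤ x i := hvx i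
    rw [hi] at h1
    exact le_antisymm h1 (SignType.neg_one_le _)

lemma haveInf_of_cofaces {e : ι → V} {x y z : ι → SignType} (hx : x ∈ covectors e)
    (hy : y ∈ covectors e) (hxz : x ≤ z) (hyz : y ≤ z) (hxu : ∀ i, z i ≠ 0 → x i = z i)
    (hyu : ∀ i, z i ≠ 0 → y i = z i) : HaveInf e x y := by
  refine ⟨scomp x y, ⟨scomp_mem_covectors hx hy, fun i => ?_, fun i => ?_⟩,
    fun u ⟨_, hux, huy⟩ i => ?_⟩
  · change scomp x y i ≤ x i
    have h1 : x i ≤ z i := hxz i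
    have h2 : y i ≤ z i := hyz i
    have h3 := hxu i; have h4 := hyu i
    simp only [scomp]
    revert h1 h2 h3 h4; generalize x i = a; generalize y i = b; generalize z i = c
    revert a b c; decide
  · change scomp x y i ≤ y i
    have h1 : x i ≤ z i := hxz i
    have h2 : y i ≤ z i := hyz i
    have h3 := hxu i; have h4 := hyu i
    simp only [scomp]
    revert h1 h2 h3 h4; generalize x i = a; generalize y i = b; generalize z i = c
    revert a b c; decide
  · change u i ≤ scomp x y i
    unfold scomp
    split_ifs
    exacts [hux i, huy i]

lemma haveInf_of_le {e : ι → V} (hlat : TopesHaveInf e) (h1 : (1 : ι → SignType) ∈ covectors e)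
    (z : ι → SignType) : z ∈ covectors e → ∀ f ∈ covectors e, ∀ g ∈ covectors e,
      f ≤ z → g ≤ z → HaveInf e f g := by
  induction z using WellFoundedLT.induction with
  | ind z ih =>
  intro hz f hf g hg hfz hgz
  by_cases hf' : f = z
  · subst hf'
    exact ⟨g, ⟨hg, hgz, le_rfl⟩, fun u hu => hu.2.2⟩
  by_cases hg' : g = z
  · subst hg'
    exact ⟨f, ⟨hf, le_rfl, hfz⟩, fun u hu => hu.2.1⟩
  obtain ⟨x, hx, hfx, hxz, hxs⟩ := exists_step hz hf hfz hf'
  obtain ⟨y, hy, hgy, hyz, hys⟩ := exists_step hz hg hgz hg'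
  obtain ⟨w, ⟨hw, hwx, hwy⟩, hwl⟩ : HaveInf e x y := by
    rcases hxs with hxs | hxs <;> rcases hys with hys | hys
    · exact haveInf_of_cofaces hx hy hxz.le hyz.le hxs hys
    · exact (haveInf_of_facet_of_coface hlat h1 hy hx hys hxs hyz.le).symm
    · exact haveInf_of_facet_of_coface hlat h1 hx hy hxs hys hxz.le
    · exact haveInf_of_facets hlat h1 hx hy hxz.le hyz.le hxs hys
  obtain ⟨p, ⟨hp, hpf, hpw⟩, hpl⟩ := ih x hxz hx f hf w hw hfx hwx
  obtain ⟨q, ⟨hq, hqp, hqg⟩, hql⟩ := ih y hyz hy p hp g hg (hpw.trans hwy) hgy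
  exact ⟨q, ⟨hq, hqp.trans hpf, hqg⟩, fun u ⟨hu, huf, hug⟩ =>
    hql ⟨hu, hpl ⟨hu, huf, hwl ⟨hu, huf.trans hfx, hug.trans hgy⟩⟩, hug⟩⟩

lemma haveInf {e : ι → V} (hlat : TopesHaveInf e) (h1 : (1 : ι → SignType) ∈ covectors e)
    {f g : ι → SignType} (hf : f ∈ covectors e) (hg : g ∈ covectors e) : HaveInf e f g :=
  haveInf_of_le hlat h1 1 h1 f hf g hg (fun _ => SignType.le_one _) fun _ => SignType.le_one _

/-! ### Regions and faces as cells of covectors -/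

/-- The closed cell of a sign vector: the points all of whose signs are zero or as prescribed. -/
def cell (e : ι → V) (s : ι → SignType) : Set V :=
  {v | ∀ i, SignType.sign ⟪e i, v⟫ = 0 ∨ SignType.sign ⟪e i, v⟫ = s i}

lemma connectedComponentIn_arrComplement (e : ι → V) {x : V} (hx : x ∈ arrComplement e) :
    connectedComponentIn (arrComplement e) x =
      {v | ∀ i, SignType.sign ⟪e i, v⟫ = SignType.sign ⟪e i, x⟫} := by
  apply Set.Subset.antisymm
  · intro v hv i
    have hpre : IsPreconnected ((fun w => ⟪e i, w⟫) '' connectedComponentIn (arrComplement e) x) :=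
      isPreconnected_connectedComponentIn.image _ (by fun_prop)
    have hord := hpre.ordConnected
    have h0 : (0 : ℝ) ∉ (fun w => ⟪e i, w⟫) '' connectedComponentIn (arrComplement e) x := by
      rintro ⟨w, hw, hw0⟩
      exact connectedComponentIn_subset _ _ hw i hw0
    have hv' := Set.mem_image_of_mem (fun w => ⟪e i, w⟫) hv
    have hx' := Set.mem_image_of_mem (fun w => ⟪e i, w⟫) (mem_connectedComponentIn hx)
    have hxi := hx i
    have hvi := connectedComponentIn_subset _ _ hv i
    rcases hvi.lt_or_gt with h | h <;> rcases hxi.lt_or_gt with h' | h'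
    · rw [sign_neg h, sign_neg h']
    · exact absurd (hord.out hv' hx' ⟨h.le, h'.le⟩) h0
    · exact absurd (hord.out hx' hv' ⟨h'.le, h.le⟩) h0
    · rw [sign_pos h, sign_pos h']
  · have hset : {v | ∀ i, SignType.sign ⟪e i, v⟫ = SignType.sign ⟪e i, x⟫} =
        ⋂ i, {v | SignType.sign ⟪e i, v⟫ = SignType.sign ⟪e i, x⟫} := by ext; simp
    refine IsPreconnected.subset_connectedComponentIn ?_ (fun i => rfl) fun v hv i => ?_
    · refine Convex.isPreconnected ?_
      rw [hset]
      refine convex_iInter fun i => ?_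
      rcases (hx i).lt_or_gt with h | h
      · simp only [sign_neg h, sign_eq_neg_one_iff]
        exact convex_halfSpace_lt (innerₛₗ ℝ (e i)).isLinear 0
      · simp only [sign_pos h, sign_eq_one_iff]
        exact convex_halfSpace_gt (innerₛₗ ℝ (e i)).isLinear 0
    · rw [← sign_ne_zero, hv i, sign_ne_zero]
      exact hx i

lemma isClosed_cell (e : ι → V) (s : ι → SignType) : IsClosed (cell e s) := by
  have : cell e s = ⋂ i, {v | SignType.sign ⟪e i, v⟫ = 0 ∨ SignType.sign ⟪e i, v⟫ = s i} := by
    ext; simp [cell]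
  rw [this]
  refine isClosed_iInter fun i => ?_
  have hc : Continuous fun v => ⟪e i, v⟫ := by fun_prop
  have h0 : (s i = 0 ∧ {v | SignType.sign ⟪e i, v⟫ = 0 ∨ SignType.sign ⟪e i, v⟫ = s i} =
        {v | ⟪e i, v⟫ = 0}) ∨
      (s i = 1 ∧ {v | SignType.sign ⟪e i, v⟫ = 0 ∨ SignType.sign ⟪e i, v⟫ = s i} =
        {v | 0 ≤ ⟪e i, v⟫}) ∨
      (s i = -1 ∧ {v | SignType.sign ⟪e i, v⟫ = 0 ∨ SignType.sign ⟪e i, v⟫ = s i} =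
        {v | ⟪e i, v⟫ ≤ 0}) := by
    rcases eq_or_ne (s i) 0 with h | h
    · left; simp [h]
    · rcases SignType.eq_neg_one_or_eq_one h with h | h
      · right; right; refine ⟨h, ?_⟩
        ext v
        simp only [h, sign_eq_zero_iff, sign_eq_neg_one_iff, Set.mem_ofPred_eq, le_iff_eq_or_lt]
      · right; left; refine ⟨h, ?_⟩
        ext v
        simp only [h, sign_eq_zero_iff, sign_eq_one_iff, Set.mem_ofPred_eq, le_iff_eq_or_lt,
          eq_comm (a := (0 : ℝ))]
  rcases h0 with ⟨-, h⟩ | ⟨-, h⟩ | ⟨-, h⟩ <;> rw [h]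
  · exact isClosed_eq hc continuous_const
  · exact isClosed_le continuous_const hc
  · exact isClosed_le hc continuous_const

lemma closure_open_cell {e : ι → V} (x : V) :
    closure {v | ∀ i, SignType.sign ⟪e i, v⟫ = SignType.sign ⟪e i, x⟫} =
      cell e fun i => SignType.sign ⟪e i, x⟫ := by
  apply Set.Subset.antisymm
  · exact closure_minimal (fun v hv i => Or.inr (hv i)) (isClosed_cell e _)
  · intro v hv
    have hc : Filter.Tendsto (fun t : ℝ => v + t • x) (nhdsWithin 0 (Set.Ioi 0)) (nhds v) := by
      have : Continuous (fun t : ℝ => v + t • x) := by fun_prop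
      simpa using (this.tendsto 0).mono_left nhdsWithin_le_nhds
    refine mem_closure_of_tendsto hc ?_
    filter_upwards [self_mem_nhdsWithin] with t ht i
    have ht : 0 < t := ht
    simp only [inner_add_right, inner_smul_right]
    rcases hv i with h | h
    · rw [sign_eq_zero_iff] at h
      simp [h, sign_mul, sign_pos ht]
    · replace h : SignType.sign ⟪e i, v⟫ = SignType.sign ⟪e i, x⟫ := h
      rcases lt_trichotomy ⟪e i, x⟫ 0 with h' | h' | h'
      · rw [sign_neg h', sign_eq_neg_one_iff] at h
        rw [sign_neg h']
        exact sign_neg (by nlinarith [mul_neg_of_pos_of_neg ht h'])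
      · rw [h', sign_zero, sign_eq_zero_iff] at h
        simp [h, h']
      · rw [sign_pos h', sign_eq_one_iff] at h
        rw [sign_pos h']
        exact sign_pos (by positivity)

lemma isRegion_iff {e : ι → V} {R : Set V} : IsRegion e R ↔ ∃ s, IsTope e s ∧ R = cell e s := by
  constructor
  · rintro ⟨x, hx, rfl⟩
    refine ⟨_, ⟨⟨x, rfl⟩, fun i => sign_ne_zero.2 (hx i)⟩, ?_⟩
    rw [connectedComponentIn_arrComplement e hx, closure_open_cell]
  · rintro ⟨_, ⟨⟨x, rfl⟩, h⟩, rfl⟩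
    have hx : x ∈ arrComplement e := fun i => sign_ne_zero.1 (h i)
    exact ⟨x, hx, by rw [connectedComponentIn_arrComplement e hx, closure_open_cell]⟩

lemma cell_subset_cell_iff {e : ι → V} {s t : ι → SignType} (hs : s ∈ covectors e) :
    cell e s ⊆ cell e t ↔ ∀ i, s i = 0 ∨ s i = t i := by
  constructor
  · obtain ⟨v, rfl⟩ := hs
    exact fun h => h fun i => Or.inr rfl
  · intro h v hv i
    rcases hv i with h' | h'
    · exact .inl h'
    · rw [h']; exact h i

lemma cell_subset_posHalf_iff {e : ι → V} {s : ι → SignType} (hs : IsTope e s) (i : ι) :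
    cell e s ⊆ posHalf e i ↔ s i = 1 := by
  obtain ⟨⟨v, rfl⟩, hv⟩ := hs
  have hi := hv i
  constructor
  · intro h
    have h1 : 0 ≤ ⟪e i, v⟫ := h fun i => Or.inr rfl
    exact sign_pos (lt_of_le_of_ne h1 (Ne.symm (sign_ne_zero.1 hi)))
  · intro h w hw
    rcases hw i with h' | h'
    · exact (sign_eq_zero_iff.1 h').ge
    · exact (sign_eq_one_iff.1 (h'.trans h)).le

lemma cell_subset_negHalf_iff {e : ι → V} {s : ι → SignType} (hs : IsTope e s) (i : ι) :
    cell e s ⊆ negHalf e i ↔ s i = -1 := by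
  obtain ⟨⟨v, rfl⟩, hv⟩ := hs
  have hi := hv i
  constructor
  · intro h
    have h1 : ⟪e i, v⟫ ≤ 0 := h fun i => Or.inr rfl
    exact sign_neg (lt_of_le_of_ne h1 (sign_ne_zero.1 hi))
  · intro h w hw
    rcases hw i with h' | h'
    · exact (sign_eq_zero_iff.1 h').le
    · exact (sign_eq_neg_one_iff.1 (h'.trans h)).le

lemma PRle_cell_iff {e : ι → V} (h1 : IsTope e 1) {s t : ι → SignType} (hs : IsTope e s)
    (ht : IsTope e t) : PRle e (cell e 1) (cell e s) (cell e t) ↔ t ≤ s := by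
  have key : ∀ {u : ι → SignType}, IsTope e u → sepSet e (cell e 1) (cell e u) = {i | u i = -1} := by
    intro u hu
    ext i
    simp [sepSet, cell_subset_posHalf_iff, cell_subset_negHalf_iff, h1, hu]
  rw [PRle, key hs, key ht]
  refine forall_congr' fun i => ?_
  have h2 := hs.2 i; have h3 := ht.2 i
  change s i = -1 → t i = -1 ↔ t i ≤ s i
  revert h2 h3; generalize s i = a; generalize t i = b; revert a b; decide

lemma isFace_cell {e : ι → V} (h1 : IsTope e 1) {s : ι → SignType} (hs : s ∈ covectors e) :
    IsFace e (cell e s) := by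
  refine ⟨{cell e (scomp s 1), cell e (scomp s (-1))}, Set.insert_nonempty _ _, ?_, ?_⟩
  · rintro R (rfl | rfl)
    · exact isRegion_iff.2 ⟨_, IsTope.scomp hs h1, rfl⟩
    · exact isRegion_iff.2 ⟨_, IsTope.scomp hs h1.neg, rfl⟩
  · ext v
    simp only [Set.sInter_insert, Set.sInter_singleton, Set.mem_inter_iff, cell, Set.mem_ofPred_eq,
      ← forall_and]
    refine forall_congr' fun i => ?_
    simp only [scomp, Pi.one_apply, Pi.neg_apply]
    generalize s i = a; generalize SignType.sign ⟪e i, v⟫ = b; revert a b; decide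

lemma IsFace.exists_cell {e : ι → V} {F : Set V} (hF : IsFace e F) :
    ∃ s ∈ covectors e, F = cell e s := by
  classical
  obtain ⟨Rs, hne, hRs, rfl⟩ := hF
  let T : Set (ι → SignType) := {t | cell e t ∈ Rs}
  let A : Set (ι → SignType) := {s | s ∈ covectors e ∧ ∀ t ∈ T, ∀ i, s i = 0 ∨ s i = t i}
  have hT : T.Nonempty := by
    obtain ⟨R, hR⟩ := hne
    obtain ⟨t, -, rfl⟩ := isRegion_iff.1 (hRs R hR)
    exact ⟨t, hR⟩
  have hmem : ∀ v, v ∈ ⋂₀ Rs ↔ (fun i => SignType.sign ⟪e i, v⟫) ∈ A := by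
    intro v
    constructor
    · exact fun h => ⟨⟨v, rfl⟩, fun t ht => h _ ht⟩
    · intro h R hR
      obtain ⟨t, -, rfl⟩ := isRegion_iff.1 (hRs R hR)
      exact h.2 t hR
  have hA0 : (0 : ι → SignType) ∈ A := ⟨⟨0, by ext; simp⟩, by simp⟩
  obtain ⟨s, ⟨hs, hsT⟩, hmax⟩ := (Set.toFinite A).exists_maximalFor
    (fun s : ι → SignType => Finset.univ.filter fun i => s i ≠ 0) A ⟨0, hA0⟩
  refine ⟨s, hs, Set.Subset.antisymm (fun v hv i => ?_) fun v hv => (hmem v).2 ?_⟩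
  · obtain ⟨h1, h2⟩ := (hmem v).1 hv
    have hcomp : scomp s (fun i => SignType.sign ⟪e i, v⟫) ∈ A := by
      refine ⟨scomp_mem_covectors hs h1, fun t ht i => ?_⟩
      unfold scomp
      split_ifs
      exacts [hsT t ht i, h2 t ht i]
    have hsub := hmax hcomp (fun i hi => by
      have hi : s i ≠ 0 := by simpa using hi
      simp [scomp, hi])
    by_cases h : SignType.sign ⟪e i, v⟫ = 0
    · exact .inl h
    · have hsi : s i ≠ 0 := by
        intro h0
        have := hsub (Finset.mem_filter.2 ⟨Finset.mem_univ i, by simpa [scomp, h0] using h⟩)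
        exact (Finset.mem_filter.1 this).2 h0
      obtain ⟨t, ht⟩ := hT
      exact .inr (((h2 t ht i).resolve_left h).trans ((hsT t ht i).resolve_left hsi).symm)
  · refine ⟨⟨v, rfl⟩, fun t ht i => ?_⟩
    rcases hv i with h | h
    · exact .inl h
    · simpa only [h] using hsT t ht i

lemma isFacialInterval_cell_iff {e : ι → V} (h1 : IsTope e 1) {s a b : ι → SignType}
    (hs : s ∈ covectors e) (ha : IsTope e a) (hb : IsTope e b) :
    IsFacialInterval e (cell e 1) (cell e s) (cell e a) (cell e b) ↔
      a = scomp s 1 ∧ b = scomp s (-1) := by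
  have hp : IsTope e (scomp s 1) := IsTope.scomp hs h1
  have hq : IsTope e (scomp s (-1)) := IsTope.scomp hs h1.neg
  have hcell : ∀ t : ι → SignType, IsTope e t →
      (cell e s ⊆ cell e t ↔ t ≤ scomp s 1 ∧ scomp s (-1) ≤ t) := by
    intro t ht
    rw [cell_subset_cell_iff hs]
    simp only [Pi.le_def, ← forall_and]
    refine forall_congr' fun i => ?_
    have h := ht.2 i
    simp only [scomp, Pi.one_apply, Pi.neg_apply]
    revert h; generalize s i = x; generalize t i = y; revert x y; decide
  have hqp : scomp s (-1) ≤ scomp s 1 := by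
    intro i
    change scomp s (-1) i ≤ scomp s 1 i
    unfold scomp
    split_ifs
    exacts [le_rfl, SignType.le_one _]
  have hiff : IsFacialInterval e (cell e 1) (cell e s) (cell e a) (cell e b) ↔
      ∀ t, IsTope e t → (t ≤ scomp s 1 ∧ scomp s (-1) ≤ t ↔ t ≤ a ∧ b ≤ t) := by
    constructor
    · rintro ⟨-, -, h⟩ t ht
      rw [← hcell t ht, h _ (isRegion_iff.2 ⟨t, ht, rfl⟩), PRle_cell_iff h1 ha ht,
        PRle_cell_iff h1 ht hb]
    · refine fun h => ⟨isRegion_iff.2 ⟨a, ha, rfl⟩, isRegion_iff.2 ⟨b, hb, rfl⟩, fun R hR => ?_⟩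
      obtain ⟨t, ht, rfl⟩ := isRegion_iff.1 hR
      rw [hcell t ht, h t ht, PRle_cell_iff h1 ha ht, PRle_cell_iff h1 ht hb]
  rw [hiff]
  constructor
  · intro h
    have hpa := (h _ hp).1 ⟨le_rfl, hqp⟩
    have hqb := (h _ hq).1 ⟨hqp, le_rfl⟩
    have hba := hpa.2.trans hpa.1
    exact ⟨le_antisymm ((h a ha).2 ⟨le_rfl, hba⟩).1 hpa.1,
      le_antisymm hqb.2 ((h b hb).2 ⟨hba, le_rfl⟩).2⟩
  · rintro ⟨rfl, rfl⟩ t -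
    rfl

lemma FWle_cell_iff {e : ι → V} (h1 : IsTope e 1) {s t : ι → SignType}
    (hs : s ∈ covectors e) (ht : t ∈ covectors e) :
    FWle e (cell e 1) (cell e s) (cell e t) ↔ t ≤ s := by
  have hp : ∀ {u}, u ∈ covectors e → IsTope e (scomp u 1) := fun h => IsTope.scomp h h1
  have hq : ∀ {u}, u ∈ covectors e → IsTope e (scomp u (-1)) := fun h => IsTope.scomp h h1.neg
  have hle : (scomp t 1 ≤ scomp s 1 ∧ scomp t (-1) ≤ scomp s (-1)) ↔ t ≤ s := by
    simp only [Pi.le_def, ← forall_and]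
    refine forall_congr' fun i => ?_
    simp only [scomp, Pi.one_apply, Pi.neg_apply]
    generalize s i = x; generalize t i = y; revert x y; decide
  rw [← hle]
  constructor
  · rintro ⟨m, M, m', M', hF, hG, hmm, hMM⟩
    obtain ⟨a, ha, rfl⟩ := isRegion_iff.1 hF.1
    obtain ⟨b, hb, rfl⟩ := isRegion_iff.1 hF.2.1
    obtain ⟨a', ha', rfl⟩ := isRegion_iff.1 hG.1
    obtain ⟨b', hb', rfl⟩ := isRegion_iff.1 hG.2.1
    obtain ⟨rfl, rfl⟩ := (isFacialInterval_cell_iff h1 hs ha hb).1 hF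
    obtain ⟨rfl, rfl⟩ := (isFacialInterval_cell_iff h1 ht ha' hb').1 hG
    exact ⟨(PRle_cell_iff h1 ha ha').1 hmm, (PRle_cell_iff h1 hb hb').1 hMM⟩
  · rintro ⟨h, h'⟩
    exact ⟨_, _, _, _, (isFacialInterval_cell_iff h1 hs (hp hs) (hq hs)).2 ⟨rfl, rfl⟩,
      (isFacialInterval_cell_iff h1 ht (hp ht) (hq ht)).2 ⟨rfl, rfl⟩,
      (PRle_cell_iff h1 (hp hs) (hp ht)).2 h, (PRle_cell_iff h1 (hq hs) (hq ht)).2 h'⟩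

lemma PRIsLattice.topesHaveInf {e : ι → V} (h1 : IsTope e 1) (h : PRIsLattice e (cell e 1)) :
    TopesHaveInf e := by
  intro s t hs ht
  obtain ⟨⟨J, hJ, hsJ, htJ, hmin⟩, -⟩ := h _ _ (isRegion_iff.2 ⟨s, hs, rfl⟩)
    (isRegion_iff.2 ⟨t, ht, rfl⟩)
  obtain ⟨j, hj, rfl⟩ := isRegion_iff.1 hJ
  refine ⟨j, hj, ⟨hj, (PRle_cell_iff h1 hs hj).1 hsJ, (PRle_cell_iff h1 ht hj).1 htJ⟩,
    fun u ⟨hu, hus, hut⟩ => (PRle_cell_iff h1 hj hu).1 ?_⟩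
  exact hmin _ (isRegion_iff.2 ⟨u, hu, rfl⟩) ((PRle_cell_iff h1 hs hu).2 hus)
    ((PRle_cell_iff h1 ht hu).2 hut)

lemma SignType.neg_le_iff {a b : SignType} : -a ≤ b ↔ -b ≤ a := by
  revert a b; decide

/-- If the poset of regions is a lattice then the facial weak order is a lattice. -/
theorem stmt15 (e : ι → V) (hne : ∀ i, e i ≠ 0) (hess : IsEssential e) (B : Set V)
    (hB : IsRegion e B) (hBpos : ∀ i, B ⊆ posHalf e i)
    (hlat : PRIsLattice e B) :
    ∀ F G, IsFace e F → IsFace e G →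
      (∃ J, IsFace e J ∧ FWle e B F J ∧ FWle e B G J ∧
        ∀ U, IsFace e U → FWle e B F U → FWle e B G U → FWle e B J U) ∧
      (∃ M, IsFace e M ∧ FWle e B M F ∧ FWle e B M G ∧
        ∀ U, IsFace e U → FWle e B U F → FWle e B U G → FWle e B U M) := by
  obtain ⟨b, hb, rfl⟩ := isRegion_iff.1 hB
  obtain rfl : b = 1 := funext fun i => (cell_subset_posHalf_iff hb i).1 (hBpos i)
  have hinf := hlat.topesHaveInf hb
  have hswap : ∀ u v : ι → SignType, -u ≤ v ↔ -v ≤ u := fun u v =>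
    forall_congr' fun i => SignType.neg_le_iff
  intro F G hF hG
  obtain ⟨f, hf, rfl⟩ := hF.exists_cell
  obtain ⟨g, hg, rfl⟩ := hG.exists_cell
  constructor
  · obtain ⟨j, ⟨hj, hjf, hjg⟩, hjl⟩ := haveInf hinf hb.1 hf hg
    refine ⟨cell e j, isFace_cell hb hj, (FWle_cell_iff hb hf hj).2 hjf,
      (FWle_cell_iff hb hg hj).2 hjg, fun U hU hFU hGU => ?_⟩
    obtain ⟨u, hu, rfl⟩ := hU.exists_cell
    exact (FWle_cell_iff hb hj hu).2
      (hjl ⟨hu, (FWle_cell_iff hb hf hu).1 hFU, (FWle_cell_iff hb hg hu).1 hGU⟩)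
  · obtain ⟨j, ⟨hj, hjf, hjg⟩, hjl⟩ :=
      haveInf hinf hb.1 (neg_mem_covectors hf) (neg_mem_covectors hg)
    have hj' := neg_mem_covectors hj
    refine ⟨cell e (-j), isFace_cell hb hj', (FWle_cell_iff hb hj' hf).2 ?_,
      (FWle_cell_iff hb hj' hg).2 ?_, fun U hU hFU hGU => ?_⟩
    · simpa using (hswap (-j) (-f)).1 (by simpa using hjf)
    · simpa using (hswap (-j) (-g)).1 (by simpa using hjg)
    · obtain ⟨u, hu, rfl⟩ := hU.exists_cell
      have huf := (FWle_cell_iff hb hu hf).1 hFU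
      have hug := (FWle_cell_iff hb hu hg).1 hGU
      refine (FWle_cell_iff hb hu hj').2 ((hswap u j).1 (hjl ⟨neg_mem_covectors hu, ?_, ?_⟩))
      · exact (hswap u (-f)).2 (by simpa using huf)
      · exact (hswap u (-g)).2 (by simpa using hug)
end

section
/- Suppose 𝒜 is essential and simplicial, and let F be a face of 𝒜 with facial interval [m_F, M_F]. Then F is join-irreducible in the facial weak order FW(𝒜,B) if and only if M_F is join-irreducible in the poset of regions PR(𝒜,B) and the codimension of F is 0 or 1. -/
open scoped RealInnerProductSpace Pointwise

variable {V : Type*} [NormedAddCommGroup V] [InnerProductSpace ℝ V] [FiniteDimensional ℝ V]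
  {ι : Type*} [Fintype ι]

set_option linter.unusedSectionVars false

namespace FacialWeak

/-- The opposite of the sign vector of a point, so that the base region has constant value `-1`
and the facial weak order becomes the componentwise order. -/
noncomputable def sg (e : ι → V) (v : V) (i : ι) : SignType := SignType.sign (-⟪e i, v⟫)

lemma sg_eq_one {e : ι → V} {v : V} {i : ι} : sg e v i = 1 ↔ ⟪e i, v⟫ < 0 := by
  simp [sg, sign_eq_one_iff]

lemma sg_eq_neg_one {e : ι → V} {v : V} {i : ι} : sg e v i = -1 ↔ 0 < ⟪e i, v⟫ := by
  simp [sg, sign_eq_neg_one_iff]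

lemma sg_eq_zero {e : ι → V} {v : V} {i : ι} : sg e v i = 0 ↔ ⟪e i, v⟫ = 0 := by
  simp [sg, sign_eq_zero_iff]

lemma sg_neg (e : ι → V) (v : V) (i : ι) : sg e (-v) i = -sg e v i := by
  simp only [sg, inner_neg_right]
  rw [Left.sign_neg (-⟪e i, v⟫)]

/-- The closed cone whose relative interior is the set of points with the sign vector of `x`. -/
def cone (e : ι → V) (x : V) : Set V := {v | ∀ i, sg e v i = 0 ∨ sg e v i = sg e x i}

lemma self_mem_cone (e : ι → V) (x : V) : x ∈ cone e x := fun _ => Or.inr rfl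

lemma cone_subset_cone {e : ι → V} {x y : V} : cone e x ⊆ cone e y ↔ x ∈ cone e y := by
  refine ⟨fun h => h (self_mem_cone e x), fun h v hv i => ?_⟩
  rcases hv i with h1 | h1
  · exact Or.inl h1
  · rw [h1]; exact h i

lemma sg_eq_of_cone_eq {e : ι → V} {x y : V} (h : cone e x = cone e y) : sg e x = sg e y := by
  have h1 : x ∈ cone e y := h ▸ self_mem_cone e x
  have h2 : y ∈ cone e x := h ▸ self_mem_cone e y
  funext i
  rcases h1 i with h1 | h1
  · rcases h2 i with h2 | h2
    · rw [h1, h2]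
    · exact h2.symm
  · exact h1

lemma cone_eq_iff {e : ι → V} {x y : V} : cone e x = cone e y ↔ sg e x = sg e y :=
  ⟨sg_eq_of_cone_eq, fun h => by simp only [cone, h]⟩

lemma mem_arrComplement {e : ι → V} {x : V} : x ∈ arrComplement e ↔ ∀ i, sg e x i ≠ 0 := by
  simp [arrComplement, sg_eq_zero]

lemma exists_perturb (e : ι → V) (z w : V) : ∃ δ : ℝ, 0 < δ ∧ ∀ i,
    (sg e z i ≠ 0 → sg e (z + δ • w) i = sg e z i) ∧
    (sg e z i = 0 → sg e (z + δ • w) i = sg e w i) := by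
  have key : ∀ᶠ δ : ℝ in nhdsWithin 0 (Set.Ioi 0), ∀ i,
      (sg e z i ≠ 0 → sg e (z + δ • w) i = sg e z i) := by
    rw [Filter.eventually_all]
    intro i
    have hc : Continuous fun δ : ℝ => ⟪e i, z + δ • w⟫ := by fun_prop
    have ht : Filter.Tendsto (fun δ : ℝ => ⟪e i, z + δ • w⟫) (nhdsWithin 0 (Set.Ioi 0))
        (nhds ⟪e i, z⟫) := by
      have := hc.tendsto 0
      simp only [zero_smul, add_zero] at this
      exact this.mono_left nhdsWithin_le_nhds
    rcases lt_trichotomy ⟪e i, z⟫ 0 with h | h | h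
    · filter_upwards [ht.eventually (eventually_lt_nhds h)] with δ hδ _
      rw [sg_eq_one.2 h, sg_eq_one.2 hδ]
    · exact Filter.Eventually.of_forall fun δ h1 => absurd (sg_eq_zero.2 h) h1
    · filter_upwards [ht.eventually (eventually_gt_nhds h)] with δ hδ _
      rw [sg_eq_neg_one.2 h, sg_eq_neg_one.2 hδ]
  obtain ⟨δ, h1, h2⟩ := (key.and self_mem_nhdsWithin).exists
  refine ⟨δ, h2, fun i => ⟨h1 i, fun h0 => ?_⟩⟩
  have hδ : (0 : ℝ) < δ := h2
  simp only [sg, inner_add_right, sg_eq_zero.1 h0, zero_add, inner_smul_right, ← mul_neg,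
    sign_mul, sign_pos hδ, one_mul]

/-! ### Regions and faces as cones -/

lemma connectedComponentIn_arrComplement {e : ι → V} {x : V} (hx : x ∈ arrComplement e) :
    connectedComponentIn (arrComplement e) x = {v | sg e v = sg e x} := by
  apply Set.Subset.antisymm
  · intro v hv
    have hpc := isPreconnected_connectedComponentIn (x := x) (F := arrComplement e)
    have hxm := mem_connectedComponentIn hx
    have hsub := connectedComponentIn_subset (arrComplement e) x
    funext i
    have himg := hpc.image (fun v => ⟪e i, v⟫) (by fun_prop)
    have h0 : (0 : ℝ) ∉ (fun v => ⟪e i, v⟫) '' connectedComponentIn (arrComplement e) x := by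
      rintro ⟨u, hu, hu0⟩
      exact hsub hu i hu0
    have hoc := himg.ordConnected
    have hvi := Set.mem_image_of_mem (fun v => ⟪e i, v⟫) hv
    have hxi := Set.mem_image_of_mem (fun v => ⟪e i, v⟫) hxm
    rcases lt_or_gt_of_ne (hsub hv i) with h | h <;> rcases lt_or_gt_of_ne (hx i) with h' | h'
    · rw [sg_eq_one.2 h, sg_eq_one.2 h']
    · exact absurd (hoc.out hvi hxi ⟨h.le, h'.le⟩) h0
    · exact absurd (hoc.out hxi hvi ⟨h'.le, h.le⟩) h0
    · rw [sg_eq_neg_one.2 h, sg_eq_neg_one.2 h']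
  · refine IsPreconnected.subset_connectedComponentIn ?_ rfl ?_
    · apply Convex.isPreconnected
      intro u hu v hv a b ha hb hab
      funext i
      have hu' := congrFun hu i
      have hv' := congrFun hv i
      rcases lt_or_gt_of_ne (hx i) with h | h
      · rw [sg_eq_one.2 h, sg_eq_one] at hu' hv' ⊢
        simp only [inner_add_right, inner_smul_right]
        rcases ha.eq_or_lt with rfl | ha
        · nlinarith
        · nlinarith
      · rw [sg_eq_neg_one.2 h, sg_eq_neg_one] at hu' hv' ⊢
        simp only [inner_add_right, inner_smul_right]
        rcases ha.eq_or_lt with rfl | ha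
        · nlinarith
        · nlinarith [mul_pos ha hu', mul_nonneg hb hv'.le]
    · intro v hv
      rw [mem_arrComplement] at hx ⊢
      intro i
      rw [congrFun hv i]
      exact hx i

lemma closure_sg_eq {e : ι → V} {x : V} (hx : x ∈ arrComplement e) :
    closure {v | sg e v = sg e x} = cone e x := by
  apply Set.Subset.antisymm
  · refine closure_minimal (fun v hv i => Or.inr (congrFun hv i)) ?_
    have : cone e x = ⋂ i, {v | 0 ≤ ⟪e i, x⟫ * ⟪e i, v⟫} := by
      ext v
      simp only [cone, Set.mem_ofPred_eq, Set.mem_iInter]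
      refine forall_congr' fun i => ?_
      rcases lt_or_gt_of_ne (hx i) with h | h
      · rw [sg_eq_one.2 h, sg_eq_zero, sg_eq_one, ← neg_mul_neg,
          mul_nonneg_iff_of_pos_left (neg_pos.2 h), neg_nonneg, or_comm, le_iff_lt_or_eq]
      · rw [sg_eq_neg_one.2 h, sg_eq_zero, sg_eq_neg_one, mul_nonneg_iff_of_pos_left h, or_comm,
          le_iff_lt_or_eq, eq_comm]
    rw [this]
    exact isClosed_iInter fun i => isClosed_le (by fun_prop) (by fun_prop)
  · intro v hv
    have ht : Filter.Tendsto (fun δ : ℝ => v + δ • x) (nhdsWithin 0 (Set.Ioi 0)) (nhds v) := by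
      have hc : Continuous fun δ : ℝ => v + δ • x := by fun_prop
      have := hc.tendsto 0
      simp only [zero_smul, add_zero] at this
      exact this.mono_left nhdsWithin_le_nhds
    refine mem_closure_of_tendsto ht ?_
    filter_upwards [self_mem_nhdsWithin] with δ hδ
    have hδ : 0 < δ := hδ
    funext i
    rcases lt_or_gt_of_ne (hx i) with h | h
    · have := hv i
      rw [sg_eq_one.2 h, sg_eq_zero, sg_eq_one] at this
      rw [sg_eq_one.2 h, sg_eq_one, inner_add_right, inner_smul_right]
      rcases this with h1 | h1 <;> nlinarith
    · have := hv i
      rw [sg_eq_neg_one.2 h, sg_eq_zero, sg_eq_neg_one] at this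
      rw [sg_eq_neg_one.2 h, sg_eq_neg_one, inner_add_right, inner_smul_right]
      rcases this with h1 | h1 <;> nlinarith [mul_pos hδ h]

lemma isRegion_iff {e : ι → V} {R : Set V} :
    IsRegion e R ↔ ∃ x, (∀ i, sg e x i ≠ 0) ∧ R = cone e x := by
  unfold IsRegion
  refine exists_congr fun x => ?_
  rw [mem_arrComplement]
  refine and_congr_right fun hx => ?_
  rw [connectedComponentIn_arrComplement (mem_arrComplement.2 hx),
    closure_sg_eq (mem_arrComplement.2 hx)]

/-- Replacing the zeros of the sign vector of `x` by `1`. -/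
lemma exists_up {e : ι → V} {b : V} (hb : ∀ i, sg e b i = -1) (x : V) :
    ∃ y, ∀ i, sg e y i ≠ 0 ∧ (sg e x i ≠ 0 → sg e y i = sg e x i) ∧
      (sg e x i = 0 → sg e y i = 1) := by
  obtain ⟨δ, -, h⟩ := exists_perturb e x (-b)
  refine ⟨x + δ • -b, fun i => ?_⟩
  have h1 : sg e (-b) i = 1 := by rw [sg_neg, hb]; rfl
  have h := h i
  rw [h1] at h
  refine ⟨?_, h⟩
  by_cases h0 : sg e x i = 0
  · rw [h.2 h0]; decide
  · rwa [h.1 h0]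

/-- Replacing the zeros of the sign vector of `x` by `-1`. -/
lemma exists_down {e : ι → V} {b : V} (hb : ∀ i, sg e b i = -1) (x : V) :
    ∃ y, ∀ i, sg e y i ≠ 0 ∧ (sg e x i ≠ 0 → sg e y i = sg e x i) ∧
      (sg e x i = 0 → sg e y i = -1) := by
  obtain ⟨δ, -, h⟩ := exists_perturb e x b
  refine ⟨x + δ • b, fun i => ?_⟩
  have h := h i
  rw [hb] at h
  refine ⟨?_, h⟩
  by_cases h0 : sg e x i = 0
  · rw [h.2 h0]; decide
  · rwa [h.1 h0]

lemma isFace_cone {e : ι → V} {b : V} (hb : ∀ i, sg e b i = -1) (x : V) :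
    IsFace e (cone e x) := by
  obtain ⟨m, hm⟩ := exists_down hb x
  obtain ⟨M, hM⟩ := exists_up hb x
  refine ⟨{cone e m, cone e M}, by simp, ?_, ?_⟩
  · rintro R (rfl | rfl)
    · exact isRegion_iff.2 ⟨m, fun i => (hm i).1, rfl⟩
    · exact isRegion_iff.2 ⟨M, fun i => (hM i).1, rfl⟩
  · ext v
    simp only [Set.sInter_insert, Set.sInter_singleton, Set.mem_inter_iff, cone, Set.mem_ofPred_eq,
      ← forall_and]
    refine forall_congr' fun i => ?_
    have hm := hm i
    have hM := hM i
    generalize sg e v i = a, sg e x i = c, sg e m i = p, sg e M i = q at *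
    revert a c p q
    decide

lemma cone_add {e : ι → V} {y : V} {u v : V} (hu : u ∈ cone e y) (hv : v ∈ cone e y) (i : ι) :
    sg e (u + v) i = if sg e u i = 0 then sg e v i else sg e u i := by
  have hu := hu i
  have hv := hv i
  rcases lt_trichotomy ⟪e i, y⟫ 0 with h | h | h
  · rw [sg_eq_one.2 h, sg_eq_zero, sg_eq_one] at hu hv
    rcases hu with hu | hu
    · simp [sg, inner_add_right, hu]
    · rw [if_neg (by rw [sg_eq_zero]; exact hu.ne), sg_eq_one.2 hu, sg_eq_one, inner_add_right]
      rcases hv with hv | hv <;> linarith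
  · rw [sg_eq_zero.2 h, or_self, sg_eq_zero] at hu hv
    simp [sg, inner_add_right, hu, hv]
  · rw [sg_eq_neg_one.2 h, sg_eq_zero, sg_eq_neg_one] at hu hv
    rcases hu with hu | hu
    · simp [sg, inner_add_right, hu]
    · rw [if_neg (by rw [sg_eq_zero]; exact hu.ne'), sg_eq_neg_one.2 hu, sg_eq_neg_one,
        inner_add_right]
      rcases hv with hv | hv <;> linarith

lemma add_mem_cone {e : ι → V} {y : V} {u v : V} (hu : u ∈ cone e y) (hv : v ∈ cone e y) :
    u + v ∈ cone e y := by
  intro i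
  rw [cone_add hu hv]
  split_ifs
  · exact hv i
  · exact hu i

lemma zero_mem_cone (e : ι → V) (y : V) : 0 ∈ cone e y := fun _ =>
  Or.inl (sg_eq_zero.2 (inner_zero_right _))

/-- A point of a face lying on as few hyperplanes as possible. -/
lemma exists_relative_interior {e : ι → V} {F : Set V} (hF : IsFace e F) (s : Finset ι) :
    ∃ x ∈ F, ∀ i ∈ s, sg e x i = 0 → ∀ v ∈ F, sg e v i = 0 := by
  classical
  obtain ⟨Rs, ⟨R₀, hR₀⟩, hR, rfl⟩ := hF
  have hadd : ∀ u ∈ ⋂₀ Rs, ∀ v ∈ ⋂₀ Rs, u + v ∈ ⋂₀ Rs := by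
    intro u hu v hv R hRR
    obtain ⟨y, -, rfl⟩ := isRegion_iff.1 (hR R hRR)
    exact add_mem_cone (hu _ hRR) (hv _ hRR)
  have hzero : (0 : V) ∈ ⋂₀ Rs := by
    intro R hRR
    obtain ⟨y, -, rfl⟩ := isRegion_iff.1 (hR R hRR)
    exact zero_mem_cone e y
  obtain ⟨y, -, rfl⟩ := isRegion_iff.1 (hR R₀ hR₀)
  induction s using Finset.induction_on with
  | empty => exact ⟨0, hzero, by simp⟩
  | insert j s _ ih =>
    obtain ⟨x, hx, ih⟩ := ih
    by_cases hj : ∀ v ∈ ⋂₀ Rs, sg e v j = 0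
    · refine ⟨x, hx, fun _ hi h0 => ?_⟩
      rcases Finset.mem_insert.1 hi with rfl | hi
      · exact hj
      · exact ih _ hi h0
    · push Not at hj
      obtain ⟨v, hv, hvj⟩ := hj
      refine ⟨x + v, hadd x hx v hv, fun j' hi h0 => ?_⟩
      rw [cone_add (hx _ hR₀) (hv _ hR₀)] at h0
      rcases Finset.mem_insert.1 hi with rfl | hi
      · split_ifs at h0 with h1
        · exact absurd h0 hvj
        · exact absurd h0 h1
      · refine ih _ hi ?_
        split_ifs at h0 with h1
        · exact h1
        · exact h0

lemma isFace_iff {e : ι → V} {b : V} (hb : ∀ i, sg e b i = -1) {F : Set V} :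
    IsFace e F ↔ ∃ x, F = cone e x := by
  constructor
  · intro hF
    obtain ⟨x, hxF, hx⟩ := exists_relative_interior hF Finset.univ
    refine ⟨x, ?_⟩
    obtain ⟨Rs, ⟨R₀, hR₀⟩, hR, rfl⟩ := hF
    apply Set.Subset.antisymm
    · intro v hv i
      obtain ⟨y, -, rfl⟩ := isRegion_iff.1 (hR R₀ hR₀)
      by_cases h0 : sg e x i = 0
      · exact Or.inl (hx i (Finset.mem_univ i) h0 v hv)
      · rw [(hxF _ hR₀ i).resolve_left h0]
        exact hv _ hR₀ i
    · intro v hv R hRR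
      obtain ⟨y, -, rfl⟩ := isRegion_iff.1 (hR R hRR)
      exact cone_subset_cone.2 (hxF _ hRR) hv
  · rintro ⟨x, rfl⟩
    exact isFace_cone hb x

/-! ### The orders in terms of sign vectors -/

lemma sepSet_cone {e : ι → V} {b y : V} (hb : ∀ i, sg e b i = -1) (hy : ∀ i, sg e y i ≠ 0) :
    sepSet e (cone e b) (cone e y) = {i | sg e y i = 1} := by
  ext i
  have hbi := sg_eq_neg_one.1 (hb i)
  simp only [sepSet, posHalf, negHalf, Set.mem_ofPred_eq]
  constructor
  · rintro (⟨-, h⟩ | ⟨h, -⟩)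
    · have h1 : ⟪e i, y⟫ ≤ 0 := h (self_mem_cone e y)
      exact sg_eq_one.2 (lt_of_le_of_ne h1 fun h0 => hy i (sg_eq_zero.2 h0))
    · exact absurd (h (self_mem_cone e b)) (not_le.2 hbi)
  · refine fun h => Or.inl ⟨fun v hv => ?_, fun v hv => ?_⟩
    · have := hv i
      rw [hb, sg_eq_zero, sg_eq_neg_one] at this
      rcases this with h1 | h1
      exacts [h1.ge, h1.le]
    · have := hv i
      rw [h, sg_eq_zero, sg_eq_one] at this
      rcases this with h1 | h1
      exacts [h1.le, h1.le]

lemma PRle_cone {e : ι → V} {b x y : V} (hb : ∀ i, sg e b i = -1) (hx : ∀ i, sg e x i ≠ 0)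
    (hy : ∀ i, sg e y i ≠ 0) : PRle e (cone e b) (cone e x) (cone e y) ↔ sg e x ≤ sg e y := by
  rw [PRle, sepSet_cone hb hx, sepSet_cone hb hy, Set.ofPred_subset_ofPred, Pi.le_def]
  refine forall_congr' fun i => ?_
  have hx := hx i
  have hy := hy i
  generalize sg e x i = a, sg e y i = c at *
  revert a c
  decide

lemma isFacialInterval_cone {e : ι → V} {b x m M : V} (hb : ∀ i, sg e b i = -1)
    (hm : ∀ i, sg e m i ≠ 0 ∧ (sg e x i ≠ 0 → sg e m i = sg e x i) ∧
      (sg e x i = 0 → sg e m i = -1))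
    (hM : ∀ i, sg e M i ≠ 0 ∧ (sg e x i ≠ 0 → sg e M i = sg e x i) ∧
      (sg e x i = 0 → sg e M i = 1)) :
    IsFacialInterval e (cone e b) (cone e x) (cone e m) (cone e M) := by
  have hm0 := fun i => (hm i).1
  have hM0 := fun i => (hM i).1
  refine ⟨isRegion_iff.2 ⟨m, hm0, rfl⟩, isRegion_iff.2 ⟨M, hM0, rfl⟩, ?_⟩
  intro R hR
  obtain ⟨y, hy, rfl⟩ := isRegion_iff.1 hR
  rw [cone_subset_cone, PRle_cone hb hm0 hy, PRle_cone hb hy hM0, Pi.le_def, Pi.le_def,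
    ← forall_and]
  refine forall_congr' fun i => ?_
  have hm := hm i
  have hM := hM i
  have hy := hy i
  generalize sg e x i = a, sg e y i = c, sg e m i = p, sg e M i = q at *
  revert a c p q
  decide

lemma isFacialInterval_cone_iff {e : ι → V} {b x m M : V} (hb : ∀ i, sg e b i = -1)
    (hm : ∀ i, sg e m i ≠ 0 ∧ (sg e x i ≠ 0 → sg e m i = sg e x i) ∧
      (sg e x i = 0 → sg e m i = -1))
    (hM : ∀ i, sg e M i ≠ 0 ∧ (sg e x i ≠ 0 → sg e M i = sg e x i) ∧
      (sg e x i = 0 → sg e M i = 1)) {R S : Set V} :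
    IsFacialInterval e (cone e b) (cone e x) R S ↔ R = cone e m ∧ S = cone e M := by
  constructor
  · rintro ⟨hR, hS, h⟩
    have hI := isFacialInterval_cone hb hm hM
    have hm0 := fun i => (hm i).1
    have hM0 := fun i => (hM i).1
    obtain ⟨y, hy, rfl⟩ := isRegion_iff.1 hR
    obtain ⟨z, hz, rfl⟩ := isRegion_iff.1 hS
    have hmM : sg e m ≤ sg e M := by
      rw [Pi.le_def]
      intro i
      have hm := hm i
      have hM := hM i
      clear * - hm hM
      generalize sg e x i = a, sg e m i = p, sg e M i = q at *
      revert a p q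
      decide
    have h1 := (h _ hI.1).1 ((hI.2.2 _ hI.1).2 ⟨(PRle_cone hb hm0 hm0).2 le_rfl,
      (PRle_cone hb hm0 hM0).2 hmM⟩)
    have h2 := (h _ hI.2.1).1 ((hI.2.2 _ hI.2.1).2 ⟨(PRle_cone hb hm0 hM0).2 hmM,
      (PRle_cone hb hM0 hM0).2 le_rfl⟩)
    rw [PRle_cone hb hy hm0, PRle_cone hb hm0 hz] at h1
    rw [PRle_cone hb hy hM0, PRle_cone hb hM0 hz] at h2
    have h3 := (hI.2.2 _ hR).1 ((h _ hR).2 ⟨(PRle_cone hb hy hy).2 le_rfl,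
      (PRle_cone hb hy hz).2 (h1.1.trans h1.2)⟩)
    have h4 := (hI.2.2 _ hS).1 ((h _ hS).2 ⟨(PRle_cone hb hy hz).2 (h1.1.trans h1.2),
      (PRle_cone hb hz hz).2 le_rfl⟩)
    rw [PRle_cone hb hm0 hy, PRle_cone hb hy hM0] at h3
    rw [PRle_cone hb hm0 hz, PRle_cone hb hz hM0] at h4
    exact ⟨cone_eq_iff.2 (le_antisymm h1.1 h3.1), cone_eq_iff.2 (le_antisymm h4.2 h2.2)⟩
  · rintro ⟨rfl, rfl⟩
    exact isFacialInterval_cone hb hm hM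

lemma FWle_cone {e : ι → V} {b x y : V} (hb : ∀ i, sg e b i = -1) :
    FWle e (cone e b) (cone e x) (cone e y) ↔ sg e x ≤ sg e y := by
  obtain ⟨m, hm⟩ := exists_down hb x
  obtain ⟨M, hM⟩ := exists_up hb x
  obtain ⟨m', hm'⟩ := exists_down hb y
  obtain ⟨M', hM'⟩ := exists_up hb y
  simp only [FWle, isFacialInterval_cone_iff hb hm hM, isFacialInterval_cone_iff hb hm' hM']
  trans PRle e (cone e b) (cone e m) (cone e m') ∧ PRle e (cone e b) (cone e M) (cone e M')
  · constructor
    · rintro ⟨_, _, _, _, ⟨rfl, rfl⟩, ⟨rfl, rfl⟩, h⟩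
      exact h
    · exact fun h => ⟨_, _, _, _, ⟨rfl, rfl⟩, ⟨rfl, rfl⟩, h⟩
  rw [PRle_cone hb (fun i => (hm i).1) (fun i => (hm' i).1),
    PRle_cone hb (fun i => (hM i).1) (fun i => (hM' i).1), Pi.le_def, Pi.le_def, Pi.le_def,
    ← forall_and]
  refine forall_congr' fun i => ?_
  have hm := hm i
  have hM := hM i
  have hm' := hm' i
  have hM' := hM' i
  clear * - hm hM hm' hM'
  generalize sg e x i = a, sg e y i = c at *
  generalize sg e m i = p, sg e M i = q at *
  generalize sg e m' i = r, sg e M' i = s at *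
  cases a <;> cases c <;> simp_all

/-- In a finite poset given as the image under `g` of the points satisfying `Q`, an element covers
exactly one other element iff the set of elements strictly below it has a maximum. -/
lemma existsUnique_cover_iff {α β γ : Type*} [PartialOrder γ] [Finite γ] {P : α → Prop}
    {lt : α → α → Prop} {Q : β → Prop} {C : β → α} {g : β → γ}
    (hP : ∀ a, P a ↔ ∃ x, Q x ∧ a = C x)
    (hlt : ∀ x y, Q x → Q y → (lt (C x) (C y) ↔ g x < g y))
    (hC : ∀ x y, C x = C y ↔ g x = g y) {p : β} (hp : Q p) :
    (∃! a, P a ∧ lt a (C p) ∧ ¬ ∃ u, P u ∧ lt a u ∧ lt u (C p)) ↔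
      ∃ q, Q q ∧ g q < g p ∧ ∀ r, Q r → g r < g p → g r ≤ g q := by
  constructor
  · rintro ⟨a, ⟨hPa, hap, -⟩, hu⟩
    obtain ⟨q, hq, rfl⟩ := (hP a).1 hPa
    refine ⟨q, hq, (hlt _ _ hq hp).1 hap, fun r hr hrp => ?_⟩
    have hfin : {c | ∃ x, Q x ∧ g x = c ∧ c < g p}.Finite := Set.toFinite _
    obtain ⟨c, hrc, ⟨⟨x, hx, rfl, hxp⟩, hmax⟩⟩ :=
      hfin.exists_le_maximal (a := g r) ⟨r, hr, rfl, hrp⟩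
    have hxq := hu (C x) ⟨(hP _).2 ⟨x, hx, rfl⟩, (hlt _ _ hx hp).2 hxp, ?_⟩
    · rwa [← (hC x q).1 hxq]
    · rintro ⟨u, hu, hxu, hup⟩
      obtain ⟨u, hQu, rfl⟩ := (hP u).1 hu
      rw [hlt _ _ hx hQu] at hxu
      rw [hlt _ _ hQu hp] at hup
      exact hxu.not_ge (hmax ⟨u, hQu, rfl, hup⟩ hxu.le)
  · rintro ⟨q, hq, hqp, hmax⟩
    refine ⟨C q, ⟨(hP _).2 ⟨q, hq, rfl⟩, (hlt _ _ hq hp).2 hqp, ?_⟩, ?_⟩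
    · rintro ⟨u, hu, hqu, hup⟩
      obtain ⟨u, hQu, rfl⟩ := (hP u).1 hu
      rw [hlt _ _ hq hQu] at hqu
      rw [hlt _ _ hQu hp] at hup
      exact hqu.not_ge (hmax u hQu hup)
    · rintro a ⟨ha, hap, hno⟩
      obtain ⟨r, hr, rfl⟩ := (hP a).1 ha
      rw [hlt _ _ hr hp] at hap
      refine (hC _ _).2 ?_
      by_contra hne
      exact hno ⟨C q, (hP _).2 ⟨q, hq, rfl⟩,
        (hlt _ _ hr hq).2 (lt_of_le_of_ne (hmax r hr hap) hne), (hlt _ _ hq hp).2 hqp⟩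

lemma existsUnique_FWcover_iff {e : ι → V} {b x : V} (hb : ∀ i, sg e b i = -1) :
    (∃! F', IsFace e F' ∧ FWcover e (cone e b) F' (cone e x)) ↔
      ∃ q, sg e q < sg e x ∧ ∀ r, sg e r < sg e x → sg e r ≤ sg e q := by
  have := existsUnique_cover_iff (P := IsFace e) (lt := FWlt e (cone e b)) (Q := fun _ => True)
    (C := cone e) (g := sg e) (fun a => by rw [isFace_iff hb]; simp)
    (fun x y _ _ => by rw [FWlt, FWle_cone hb, Ne, cone_eq_iff, lt_iff_le_and_ne])
    (fun x y => cone_eq_iff) (p := x) trivial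
  simpa [FWcover] using this

lemma existsUnique_PRcover_iff {e : ι → V} {b y : V} (hb : ∀ i, sg e b i = -1)
    (hy : ∀ i, sg e y i ≠ 0) :
    (∃! R, IsRegion e R ∧ PRcover e (cone e b) R (cone e y)) ↔
      ∃ q, (∀ i, sg e q i ≠ 0) ∧ sg e q < sg e y ∧
        ∀ r, (∀ i, sg e r i ≠ 0) → sg e r < sg e y → sg e r ≤ sg e q :=
  existsUnique_cover_iff (P := IsRegion e) (lt := PRlt e (cone e b))
    (Q := fun v => ∀ i, sg e v i ≠ 0) (C := cone e) (g := sg e) (fun _ => isRegion_iff)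
    (fun x y hx hy => by rw [PRlt, PRle_cone hb hx hy, Ne, cone_eq_iff, lt_iff_le_and_ne])
    (fun x y => cone_eq_iff) hy

/-! ### Walls of regions -/

lemma fdim_add_one_of_hyperplane {S : Set V} {a p : V} (ha : a ≠ 0) (hS : ∀ v ∈ S, ⟪a, v⟫ = 0)
    (hp : p ∈ S) (h : ∀ v, ⟪a, v⟫ = 0 → ∃ δ : ℝ, 0 < δ ∧ p + δ • v ∈ S) :
    fdim S + 1 = Module.finrank ℝ V := by
  have hspan : Submodule.span ℝ S = (ℝ ∙ a)ᗮ := by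
    apply le_antisymm
    · exact Submodule.span_le.2 fun v hv => Submodule.mem_orthogonal_singleton_iff_inner_right.2
        (hS v hv)
    · intro v hv
      obtain ⟨δ, hδ, hδS⟩ := h v (Submodule.mem_orthogonal_singleton_iff_inner_right.1 hv)
      have h1 := Submodule.sub_mem _ (Submodule.subset_span (R := ℝ) hδS)
        (Submodule.subset_span hp)
      rw [add_sub_cancel_left] at h1
      exact (Submodule.smul_mem_iff _ hδ.ne').1 h1
  rw [fdim, hspan, ← Submodule.finrank_add_finrank_orthogonal (ℝ ∙ a), finrank_span_singleton ha,
    add_comm]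

lemma fdim_eq_finrank {S : Set V} {p : V} (hp : p ∈ S)
    (h : ∀ v, ∃ δ : ℝ, 0 < δ ∧ p + δ • v ∈ S) : fdim S = Module.finrank ℝ V := by
  have hspan : Submodule.span ℝ S = ⊤ := by
    refine eq_top_iff.2 fun v _ => ?_
    obtain ⟨δ, hδ, hδS⟩ := h v
    have h1 := Submodule.sub_mem _ (Submodule.subset_span (R := ℝ) hδS) (Submodule.subset_span hp)
    rw [add_sub_cancel_left] at h1
    exact (Submodule.smul_mem_iff _ hδ.ne').1 h1
  rw [fdim, hspan, finrank_top]

/-- The region of `y` is a simplicial cone cut out by the hyperplanes indexed by `W`: its defining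
inequalities are those indexed by `W`, and the corresponding linear forms are independent. -/
structure IsSimplicialCone (e : ι → V) (y : V) (W : Finset ι) : Prop where
  ne_zero : ∀ i, sg e y i ≠ 0
  mem_cone : ∀ v, (∀ i ∈ W, sg e v i = 0 ∨ sg e v i = sg e y i) → v ∈ cone e y
  exists_inner_eq : ∀ c : ι → ℝ, ∃ v, ∀ i ∈ W, ⟪e i, v⟫ = c i

lemma exists_inner_eq_of_linearIndependent {κ : Type*} {a : κ → V} (ha : LinearIndependent ℝ a)
    (c : κ → ℝ) : ∃ v, ∀ i, ⟪a i, v⟫ = c i := by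
  obtain ⟨φ, hφ⟩ := LinearMap.exists_extend ((Module.Basis.span ha).constr ℝ c)
  refine ⟨(InnerProductSpace.toDual ℝ V).symm (LinearMap.toContinuousLinearMap φ), fun i => ?_⟩
  rw [real_inner_comm, InnerProductSpace.toDual_symm_apply]
  have := LinearMap.congr_fun hφ (Module.Basis.span ha i)
  rw [Module.Basis.constr_basis] at this
  simpa [Module.Basis.span_apply] using this

lemma exists_isSimplicialCone {e : ι → V} (hne : ∀ i, e i ≠ 0) {y : V}
    (hy : ∀ i, sg e y i ≠ 0) (hs : IsSimplicialRegion e (cone e y)) :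
    ∃ W, IsSimplicialCone e y W := by
  classical
  have hex : ∃ W : Finset ι, Minimal (fun W : Finset ι =>
      ∀ v, (∀ i ∈ W, sg e v i = 0 ∨ sg e v i = sg e y i) → v ∈ cone e y) W :=
    exists_minimal_of_wellFoundedLT _ ⟨Finset.univ, fun v hv i => hv i (Finset.mem_univ i)⟩
  obtain ⟨W, hW, hmin⟩ := hex
  have hwall : ∀ i ∈ W, IsWall e (cone e y) i := by
    intro i hi
    have h1 : ¬ ∀ v, (∀ j ∈ W.erase i, sg e v j = 0 ∨ sg e v j = sg e y j) → v ∈ cone e y :=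
      fun h => Finset.notMem_erase i W (hmin h (Finset.erase_subset i W) hi)
    push Not at h1
    obtain ⟨v, hv, hvy⟩ := h1
    have hvi : sg e v i ≠ 0 ∧ sg e v i ≠ sg e y i := by
      rw [← not_or]
      refine fun h => hvy (hW v fun j hj => ?_)
      by_cases hji : j = i
      · exact hji ▸ h
      · exact hv j (Finset.mem_erase.2 ⟨hji, hj⟩)
    obtain ⟨p, hpi, hp⟩ : ∃ p, sg e p i = 0 ∧ ∀ j ∈ W, j ≠ i → sg e p j = sg e y j := by
      have hvi0 : ⟪e i, v⟫ ≠ 0 := fun h => hvi.1 (sg_eq_zero.2 h)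
      have hyi0 : ⟪e i, y⟫ ≠ 0 := fun h => hy i (sg_eq_zero.2 h)
      refine ⟨|⟪e i, v⟫| • y + |⟪e i, y⟫| • v, ?_, fun j hj hji => ?_⟩
      · rw [sg_eq_zero, inner_add_right, inner_smul_right, inner_smul_right]
        rcases lt_or_gt_of_ne hvi0 with h | h <;> rcases lt_or_gt_of_ne hyi0 with h' | h'
        · exact absurd ((sg_eq_one.2 h).trans (sg_eq_one.2 h').symm) hvi.2
        · rw [abs_of_neg h, abs_of_pos h']; ring
        · rw [abs_of_pos h, abs_of_neg h']; ring
        · exact absurd ((sg_eq_neg_one.2 h).trans (sg_eq_neg_one.2 h').symm) hvi.2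
      · have hvj := hv j (Finset.mem_erase.2 ⟨hji, hj⟩)
        have hva := abs_pos.2 hvi0
        have hya := abs_pos.2 hyi0
        rcases lt_trichotomy ⟪e j, y⟫ 0 with h | h | h
        · rw [sg_eq_one.2 h, sg_eq_zero, sg_eq_one] at hvj
          rw [sg_eq_one.2 h, sg_eq_one, inner_add_right, inner_smul_right, inner_smul_right]
          rcases hvj with h1 | h1 <;> nlinarith
        · exact absurd (sg_eq_zero.2 h) (hy j)
        · rw [sg_eq_neg_one.2 h, sg_eq_zero, sg_eq_neg_one] at hvj
          rw [sg_eq_neg_one.2 h, sg_eq_neg_one, inner_add_right, inner_smul_right,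
            inner_smul_right]
          rcases hvj with h1 | h1
          · rw [h1, mul_zero, add_zero]; positivity
          · positivity
    have hdim : fdim ({v : V | ⟪e i, v⟫ = 0} ∩ cone e y) + 1 = Module.finrank ℝ V := by
      refine fdim_add_one_of_hyperplane (hne i) (fun v hv => hv.1) (p := p)
        ⟨sg_eq_zero.1 hpi, hW p fun j hj => ?_⟩ fun w hw => ?_
      · by_cases hji : j = i
        · exact Or.inl (hji ▸ hpi)
        · exact Or.inr (hp j hj hji)
      · obtain ⟨δ, hδ, h⟩ := exists_perturb e p w
        have hi0 : sg e (p + δ • w) i = 0 := by rw [(h i).2 hpi]; exact sg_eq_zero.2 hw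
        refine ⟨δ, hδ, sg_eq_zero.1 hi0, hW _ fun j hj => ?_⟩
        by_cases hji : j = i
        · exact Or.inl (hji ▸ hi0)
        · have hpj := hp j hj hji
          rw [(h j).1 (hpj ▸ hy j)]
          exact Or.inr hpj
    rw [IsWall]
    omega
  refine ⟨W, hy, hW, fun c => ?_⟩
  obtain ⟨v, hv⟩ := exists_inner_eq_of_linearIndependent hs fun i => c i
  exact ⟨v, fun i hi => hv ⟨i, hwall i hi⟩⟩

namespace IsSimplicialCone

variable {e : ι → V} {y : V} {W : Finset ι}

/-- If `z` lies in the region and `w` points into the region along the walls containing `z`, then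
`w` points into the region along all hyperplanes containing `z`. -/
lemma sg_of_zero (h : IsSimplicialCone e y W) {z w : V} (hz : z ∈ cone e y)
    (hw : ∀ i ∈ W, sg e z i = 0 → sg e w i = 0 ∨ sg e w i = sg e y i) {j : ι}
    (hj : sg e z j = 0) : sg e w j = 0 ∨ sg e w j = sg e y j := by
  obtain ⟨δ, -, hδ⟩ := exists_perturb e z w
  rw [← (hδ j).2 hj]
  refine h.mem_cone _ (fun i hi => ?_) j
  by_cases h0 : sg e z i = 0
  · rw [(hδ i).2 h0]; exact hw i hi h0
  · rw [(hδ i).1 h0]; exact hz i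

lemma zero_of_zero (h : IsSimplicialCone e y W) {p q : V} (hp : p ∈ cone e y)
    (hq : q ∈ cone e y) (hpq : ∀ i ∈ W, sg e p i = 0 → sg e q i = 0) {j : ι}
    (hj : sg e p j = 0) : sg e q j = 0 := by
  have h1 := h.sg_of_zero hp (w := -q) (fun i hi h0 => Or.inl (by simp [sg_neg, hpq i hi h0])) hj
  have h2 := hq j
  have h3 := h.ne_zero j
  rw [sg_neg] at h1
  generalize sg e q j = a, sg e y j = c at *
  clear * - h1 h2 h3
  revert a c
  decide

lemma sg_eq (h : IsSimplicialCone e y W) {p q : V} (hq : q ∈ cone e y)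
    (hpq : ∀ i ∈ W, sg e p i = sg e q i) : sg e p = sg e q := by
  have hp : p ∈ cone e y := h.mem_cone _ fun i hi => hpq i hi ▸ hq i
  funext j
  by_cases h0 : sg e p j = 0
  · rw [h0, h.zero_of_zero hp hq (fun i hi => (hpq i hi ▸ ·)) h0]
  · by_cases h1 : sg e q j = 0
    · exact absurd (h.zero_of_zero hq hp (fun i hi h2 => (hpq i hi).trans h2) h1) h0
    · rw [(hp j).resolve_left h0, (hq j).resolve_left h1]

/-- The faces of a simplicial cone: any set of walls is the set of walls containing some face. -/
lemma exists_face (h : IsSimplicialCone e y W) (I : Set ι) : ∃ z ∈ cone e y, ∀ i ∈ W,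
    (i ∈ I → sg e z i = 0) ∧ (i ∉ I → sg e z i = sg e y i) := by
  classical
  obtain ⟨z, hz⟩ := h.exists_inner_eq fun i => if i ∈ I then 0 else ⟪e i, y⟫
  have hz' : ∀ i ∈ W, (i ∈ I → sg e z i = 0) ∧ (i ∉ I → sg e z i = sg e y i) := fun i hi =>
    ⟨fun hI => by rw [sg_eq_zero, hz i hi, if_pos hI],
      fun hI => by simp only [sg, hz i hi, if_neg hI]⟩
  refine ⟨z, h.mem_cone z fun i hi => ?_, hz'⟩
  by_cases hI : i ∈ I
  · exact Or.inl ((hz' i hi).1 hI)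
  · exact Or.inr ((hz' i hi).2 hI)

/-- If all walls containing `z` separate the region from the base region, then so do all hyperplanes
containing `z`. -/
lemma eq_one_of_zero (h : IsSimplicialCone e y W) {b : V} (hb : ∀ i, sg e b i = -1) {z : V}
    (hz : z ∈ cone e y) (hD : ∀ i ∈ W, sg e z i = 0 → sg e y i = 1) {j : ι}
    (hj : sg e z j = 0) : sg e y j = 1 := by
  have hb' : ∀ i, sg e (-b) i = 1 := fun i => by rw [sg_neg, hb]; rfl
  have h1 := h.sg_of_zero hz (w := -b) (fun i hi h0 => Or.inr ((hb' i).trans (hD i hi h0).symm)) hj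
  rw [hb'] at h1
  exact (h1.resolve_left (by decide)).symm

end IsSimplicialCone

/-! ### Join-irreducibility and lower walls -/

lemma neg_one_le_signType (a : SignType) : -1 ≤ a := by
  revert a; decide

lemma signType_le_one (a : SignType) : a ≤ 1 := by
  revert a; decide

/-- The region of `y` has exactly one wall separating it from the base region. -/
def HasUniqueLowerWall (e : ι → V) (y : V) (W : Finset ι) : Prop :=
  ∃ i ∈ W, sg e y i = 1 ∧ ∀ k ∈ W, sg e y k = 1 → k = i

/-- The region of `y` is the top of the facial interval of the face of `x`. -/
def IsTop (e : ι → V) (x y : V) : Prop :=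
  ∀ i, (sg e x i ≠ 0 → sg e y i = sg e x i) ∧ (sg e x i = 0 → sg e y i = 1)

lemma IsTop.mem_cone {e : ι → V} {x y : V} (h : IsTop e x y) : x ∈ cone e y := fun i => by
  by_cases h0 : sg e x i = 0
  · exact Or.inl h0
  · exact Or.inr ((h i).1 h0).symm

lemma IsTop.le {e : ι → V} {x y : V} (h : IsTop e x y) : sg e x ≤ sg e y := fun i => by
  by_cases h0 : sg e x i = 0
  · rw [(h i).2 h0]; exact signType_le_one _
  · exact ((h i).1 h0).ge

namespace IsSimplicialCone

variable {e : ι → V} {b x y : V} {W : Finset ι}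

lemma exists_wall_zero (h : IsSimplicialCone e y W) (hx : x ∈ cone e y)
    (hne : sg e x ≠ sg e y) : ∃ i ∈ W, sg e x i = 0 := by
  by_contra! h0
  exact hne (h.sg_eq (self_mem_cone e y) fun i hi => (hx i).resolve_left (h0 i hi))

lemma exists_lower_wall (h : IsSimplicialCone e y W) (hb : ∀ i, sg e b i = -1) {q : V}
    (hq : sg e q < sg e y) : ∃ i ∈ W, sg e y i = 1 := by
  by_contra! h1
  have hby : sg e b = sg e y := h.sg_eq (self_mem_cone e y) fun i hi => by
    have h2 := h1 i hi
    have h3 := h.ne_zero i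
    rw [hb]
    generalize sg e y i = a at *
    clear * - h2 h3
    revert a
    decide
  exact hq.not_ge fun i => by rw [← hby, hb]; exact neg_one_le_signType _

/-- The facets of a simplicial cone on its lower walls are lower faces. -/
lemma exists_lower_face (h : IsSimplicialCone e y W) (hb : ∀ i, sg e b i = -1) {i : ι}
    (hyi : sg e y i = 1) : ∃ z ∈ cone e y, (∀ k ∈ W, sg e z k = 0 ↔ k = i) ∧ IsTop e z y := by
  obtain ⟨z, hz, hzW⟩ := h.exists_face {i}
  have hzi : ∀ k ∈ W, sg e z k = 0 ↔ k = i := fun k hk => by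
    refine ⟨fun h0 => ?_, fun hki => (hzW k hk).1 hki⟩
    by_contra hki
    exact h.ne_zero k (((hzW k hk).2 hki).symm.trans h0)
  refine ⟨z, hz, hzi, fun j => ⟨fun h0 => ((hz j).resolve_left h0).symm, fun h0 => ?_⟩⟩
  exact h.eq_one_of_zero hb hz (fun k hk hk0 => (hzi k hk).1 hk0 ▸ hyi) h0

lemma hasUniqueLowerWall_of_le (h : IsSimplicialCone e y W) (hb : ∀ i, sg e b i = -1) {q : V}
    (hq : sg e q < sg e y)
    (hle : ∀ z ∈ cone e y, IsTop e z y → sg e z < sg e y → ∃ r, sg e r ≤ sg e q ∧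
      ∀ j, sg e z j ≠ 0 → sg e r j = sg e z j) :
    HasUniqueLowerWall e y W := by
  obtain ⟨i, hi, hyi⟩ := h.exists_lower_wall hb hq
  refine ⟨i, hi, hyi, fun k hk hyk => ?_⟩
  by_contra hki
  have key : ∀ l ∈ W, sg e y l = 1 → ∀ j ∈ W, j ≠ l → sg e q j = sg e y j := by
    intro l hl hyl j hj hjl
    obtain ⟨z, hz, hzW, hzt⟩ := h.exists_lower_face hb hyl
    have hlt : sg e z < sg e y := by
      refine lt_of_le_of_ne hzt.le fun heq => ?_
      exact h.ne_zero l (heq ▸ (hzW l hl).2 rfl)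
    obtain ⟨r, hrq, hr⟩ := hle z hz hzt hlt
    have hzj : sg e z j ≠ 0 := fun h0 => hjl ((hzW j hj).1 h0)
    refine le_antisymm (hq.le j) ?_
    rw [← (hz j).resolve_left hzj, ← hr j hzj]
    exact hrq j
  refine hq.ne (h.sg_eq (self_mem_cone e y) fun j hj => ?_)
  by_cases hji : j = i
  · exact key k hk hyk j hj fun hjk => hki (hjk.symm.trans hji)
  · exact key i hi hyi j hj hji

/-- Points weakly beyond the only wall containing `z` lie weakly beyond all hyperplanes
containing `z`. -/
lemma nonpos_of_zero (h : IsSimplicialCone e y W) {z r : V} {i : ι} (hz : IsTop e z y)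
    (hzW : ∀ k ∈ W, sg e z k = 0 → k = i) (hr : sg e r i ≠ 1) {j : ι} (hj : sg e z j = 0) :
    sg e r j ≤ 0 := by
  have h1 := h.sg_of_zero hz.mem_cone (w := -r) (fun k hk hk0 => by
    have hyk := (hz k).2 hk0
    obtain rfl := hzW k hk hk0
    rw [sg_neg, hyk]
    generalize sg e r k = a at *
    clear * - hr
    revert a
    decide) hj
  rw [sg_neg, (hz j).2 hj] at h1
  generalize sg e r j = a at *
  clear * - h1
  revert a
  decide

/-- Points strictly beyond the only wall containing `z` lie strictly beyond all hyperplanes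
containing `z`. -/
lemma eq_neg_one_of_zero (h : IsSimplicialCone e y W) {z r : V} {i : ι} (hz : IsTop e z y)
    (hzW : ∀ k ∈ W, sg e z k = 0 → k = i) (hr : sg e r i = -1) {j : ι} (hj : sg e z j = 0) :
    sg e r j = -1 := by
  obtain ⟨δ, -, hδ⟩ := exists_perturb e r y
  have h1 := h.nonpos_of_zero hz hzW (r := r) (by rw [hr]; decide) hj
  have h2 := h.nonpos_of_zero hz hzW (r := r + δ • y)
    (by rw [(hδ i).1 (by rw [hr]; decide), hr]; decide) hj
  by_cases h0 : sg e r j = 0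
  · rw [(hδ j).2 h0, (hz j).2 hj] at h2
    exact absurd h2 (by decide)
  · generalize sg e r j = a at *
    clear * - h0 h1
    revert a
    decide

lemma PR_irreducible_iff (h : IsSimplicialCone e y W) (hb : ∀ i, sg e b i = -1) :
    (∃ q, (∀ i, sg e q i ≠ 0) ∧ sg e q < sg e y ∧
      ∀ r, (∀ i, sg e r i ≠ 0) → sg e r < sg e y → sg e r ≤ sg e q) ↔
      HasUniqueLowerWall e y W := by
  constructor
  · rintro ⟨q, -, hqy, hmax⟩
    refine h.hasUniqueLowerWall_of_le hb hqy fun z hz hzt hlt => ?_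
    obtain ⟨r, hr⟩ := exists_down hb z
    refine ⟨r, hmax r (fun j => (hr j).1) (lt_of_le_of_lt (fun j => ?_) hlt), fun j => (hr j).2.1⟩
    by_cases h0 : sg e z j = 0
    · rw [(hr j).2.2 h0]; exact neg_one_le_signType _
    · exact ((hr j).2.1 h0).le
  · rintro ⟨i, hi, hyi, hD⟩
    obtain ⟨z, hz, hzW, hzt⟩ := h.exists_lower_face hb hyi
    obtain ⟨q, hq⟩ := exists_down hb z
    have hqi := (hq i).2.2 ((hzW i hi).2 rfl)
    refine ⟨q, fun j => (hq j).1, lt_of_le_of_ne (fun j => ?_) fun heq => ?_, ?_⟩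
    · by_cases h0 : sg e z j = 0
      · rw [(hq j).2.2 h0]; exact neg_one_le_signType _
      · rw [(hq j).2.1 h0]; exact hzt.le j
    · rw [heq, hyi] at hqi
      exact absurd hqi (by decide)
    · intro r hr hry j
      by_cases h0 : sg e z j = 0
      · have hri : sg e r i ≠ 1 := fun hri => by
          refine hry.ne (h.sg_eq (self_mem_cone e y) fun k hk => ?_)
          by_cases hki : k = i
          · rw [hki, hri, hyi]
          · have h1 : sg e r k ≤ sg e y k := hry.le k
            have h2 := h.ne_zero k
            have h3 := fun h3 => hki (hD k hk h3)
            generalize sg e r k = a, sg e y k = c at *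
            clear * - h1 h2 h3
            revert a c
            decide
        have h1 := h.nonpos_of_zero hzt (fun k hk => (hzW k hk).1) hri h0
        have h2 := hr j
        rw [(hq j).2.2 h0]
        change sg e r j ≤ -1
        generalize sg e r j = a at *
        clear * - h1 h2
        revert a
        decide
      · rw [(hq j).2.1 h0, ← (hzt j).1 h0]
        exact hry.le j

lemma FW_irreducible_of_hasUniqueLowerWall (h : IsSimplicialCone e y W)
    (hb : ∀ i, sg e b i = -1) (hxy : IsTop e x y) (hW : HasUniqueLowerWall e y W) :
    ∃ q, sg e q < sg e x ∧ ∀ r, sg e r < sg e x → sg e r ≤ sg e q := by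
  obtain ⟨i, hi, hyi, hD⟩ := hW
  have hrk : ∀ r, sg e r < sg e x → ∀ k ∈ W, k ≠ i → sg e r k = sg e y k := by
    intro r hr k hk hki
    have h1 : sg e r k ≤ sg e y k := (hr.le.trans hxy.le) k
    have h2 := h.ne_zero k
    have h3 := fun h3 => hki (hD k hk h3)
    generalize sg e r k = a, sg e y k = c at *
    clear * - h1 h2 h3
    revert a c
    decide
  by_cases hx : sg e x = sg e y
  · rw [hx] at hrk ⊢
    obtain ⟨z, hz, hzW, hzt⟩ := h.exists_lower_face hb hyi
    refine ⟨z, lt_of_le_of_ne hzt.le fun heq => ?_, fun r hr j => ?_⟩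
    · exact h.ne_zero i (heq ▸ (hzW i hi).2 rfl)
    · by_cases h0 : sg e z j = 0
      · rw [h0]
        refine h.nonpos_of_zero hzt (fun k hk => (hzW k hk).1) (fun hri => ?_) h0
        refine hr.ne (h.sg_eq (self_mem_cone e y) fun k hk => ?_)
        by_cases hki : k = i
        · rw [hki, hri, hyi]
        · exact hrk r hr k hk hki
      · rw [← (hzt j).1 h0]; exact hr.le j
  · have hxW : ∀ k ∈ W, sg e x k = 0 → k = i := fun k hk hk0 => hD k hk ((hxy k).2 hk0)
    obtain ⟨i', hi', hxi⟩ := h.exists_wall_zero hxy.mem_cone hx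
    obtain rfl := hxW i' hi' hxi
    obtain ⟨q, hq⟩ := exists_down hb x
    refine ⟨q, lt_of_le_of_ne (fun j => ?_) fun heq => ?_, fun r hr j => ?_⟩
    · by_cases h0 : sg e x j = 0
      · rw [(hq j).2.2 h0]; exact neg_one_le_signType _
      · exact ((hq j).2.1 h0).le
    · exact (hq i').1 (heq ▸ hxi)
    · by_cases h0 : sg e x j = 0
      · rw [(hq j).2.2 h0]
        refine (h.eq_neg_one_of_zero hxy hxW ?_ h0).le
        have hri : sg e r i' ≠ 0 := fun hri => by
          refine hr.ne (h.sg_eq hxy.mem_cone fun k hk => ?_)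
          by_cases hki : k = i'
          · rw [hki, hri, hxi]
          · rw [hrk r hr k hk hki]
            exact (hxy k).1 fun h0 => hki (hxW k hk h0)
        have h1 : sg e r i' ≤ sg e x i' := hr.le i'
        rw [hxi] at h1
        generalize sg e r i' = a at *
        clear * - hri h1
        revert a
        decide
      · rw [(hq j).2.1 h0]; exact hr.le j

lemma fdim_of_hasUniqueLowerWall (h : IsSimplicialCone e y W) (hne : ∀ i, e i ≠ 0)
    (hxy : IsTop e x y) (hW : HasUniqueLowerWall e y W) :
    fdim (cone e x) = Module.finrank ℝ V ∨ fdim (cone e x) + 1 = Module.finrank ℝ V := by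
  obtain ⟨i, hi, hyi, hD⟩ := hW
  by_cases hx : sg e x = sg e y
  · refine Or.inl (fdim_eq_finrank (self_mem_cone e x) fun v => ?_)
    obtain ⟨δ, hδ, hv⟩ := exists_perturb e x v
    exact ⟨δ, hδ, fun j => Or.inr ((hv j).1 (hx ▸ h.ne_zero j))⟩
  · have hxW : ∀ k ∈ W, sg e x k = 0 → k = i := fun k hk hk0 => hD k hk ((hxy k).2 hk0)
    obtain ⟨i', hi', hxi⟩ := h.exists_wall_zero hxy.mem_cone hx
    obtain rfl := hxW i' hi' hxi
    refine Or.inr (fdim_add_one_of_hyperplane (hne i') (fun v hv => ?_) (self_mem_cone e x)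
      fun v hv => ?_)
    · have := hv i'
      rw [hxi, or_self] at this
      exact sg_eq_zero.1 this
    · obtain ⟨δ, hδ, hδv⟩ := exists_perturb e x v
      refine ⟨δ, hδ, fun j => ?_⟩
      by_cases h0 : sg e x j = 0
      · left
        have hv0 := sg_eq_zero.2 hv
        rw [(hδv j).2 h0]
        have h1 := h.nonpos_of_zero hxy hxW (r := v) (by rw [hv0]; decide) h0
        have h2 := h.nonpos_of_zero hxy hxW (r := -v) (by rw [sg_neg, hv0]; decide) h0
        rw [sg_neg] at h2
        generalize sg e v j = a at *
        clear * - h1 h2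
        revert a
        decide
      · exact Or.inr ((hδv j).1 h0)

/-- A face below which there is a greatest strictly smaller face lies on at most one wall of the
bottom `m` of its facial interval. -/
lemma eq_of_zero_of_bottom {m q : V} {U : Finset ι} (h : IsSimplicialCone e m U)
    (hm : ∀ i, (sg e x i ≠ 0 → sg e m i = sg e x i) ∧ (sg e x i = 0 → sg e m i = -1))
    (hq : sg e q < sg e x) (hmax : ∀ r, sg e r < sg e x → sg e r ≤ sg e q)
    {u u' : ι} (hu : u ∈ U) (hu' : u' ∈ U) (hxu : sg e x u = 0) (hxu' : sg e x u' = 0) :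
    u' = u := by
  by_contra hne
  have hxm : x ∈ cone e m := fun i => by
    by_cases h0 : sg e x i = 0
    · exact Or.inl h0
    · exact Or.inr ((hm i).1 h0).symm
  have key : ∀ l ∈ U, sg e x l = 0 → ∀ j ∈ U, j ≠ l → sg e q j = sg e x j := by
    intro l hl hxl j hj hjl
    obtain ⟨g, hg, hgU⟩ := h.exists_face {k | sg e x k = 0 ∧ k ≠ l}
    have hgx : sg e g < sg e x := by
      refine lt_of_le_of_ne (fun k => ?_) fun heq => ?_
      · by_cases h0 : sg e x k = 0
        · rw [h0]
          rcases hg k with h1 | h1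
          · exact h1.le
          · rw [h1, (hm k).2 h0]; exact neg_one_le_signType 0
        · rw [← (hm k).1 h0]
          refine ((hg k).resolve_left fun hk0 => h0 ?_).le
          refine h.zero_of_zero hg hxm (fun i hi hi0 => ?_) hk0
          by_contra hi1
          exact h.ne_zero i (((hgU i hi).2 fun hi2 => hi1 hi2.1).symm.trans hi0)
      · exact h.ne_zero l (((hgU l hl).2 fun h2 => h2.2 rfl).symm.trans (heq ▸ hxl))
    refine le_antisymm (hq.le j) (le_trans ?_ (hmax g hgx j))
    by_cases h0 : sg e x j = 0
    · rw [h0, (hgU j hj).1 ⟨h0, hjl⟩]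
    · rw [(hgU j hj).2 fun h1 => h0 h1.1, (hm j).1 h0]
  refine hq.ne (h.sg_eq hxm fun j hj => ?_)
  by_cases hj' : j = u
  · exact key u' hu' hxu' j hj fun h1 => hne (h1.symm.trans hj')
  · exact key u hu hxu j hj hj'

lemma hasUniqueLowerWall_of_FW_irreducible {m q : V} {U : Finset ι} (h : IsSimplicialCone e y W)
    (hU : IsSimplicialCone e m U) (hb : ∀ i, sg e b i = -1) (hxy : IsTop e x y)
    (hm : ∀ i, (sg e x i ≠ 0 → sg e m i = sg e x i) ∧ (sg e x i = 0 → sg e m i = -1))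
    (hq : sg e q < sg e x) (hmax : ∀ r, sg e r < sg e x → sg e r ≤ sg e q) :
    HasUniqueLowerWall e y W := by
  by_cases hx : sg e x = sg e y
  · rw [hx] at hq hmax
    exact h.hasUniqueLowerWall_of_le hb hq fun z _ _ hz => ⟨z, hmax z hz, fun _ _ => rfl⟩
  have hxm : x ∈ cone e m := fun i => by
    by_cases h0 : sg e x i = 0
    · exact Or.inl h0
    · exact Or.inr ((hm i).1 h0).symm
  obtain ⟨i, hi, hxi⟩ := h.exists_wall_zero hxy.mem_cone hx
  obtain ⟨u, hu, hxu⟩ := hU.exists_wall_zero hxm fun heq => hU.ne_zero i (heq ▸ hxi)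
  have huU : ∀ k ∈ U, sg e x k = 0 → k = u := fun k hk hk0 =>
    hU.eq_of_zero_of_bottom hm hq hmax hu hk hxu hk0
  have hiW : ∀ k ∈ W, sg e x k = 0 → k = i := by
    classical
    intro k hk hxk
    by_contra hki
    obtain ⟨v, hv⟩ := h.exists_inner_eq fun j => if j = i then 1 else -1
    have hvi : sg e v i = -1 := by rw [sg_eq_neg_one, hv i hi, if_pos rfl]; exact one_pos
    have hvk : sg e v k = 1 := by rw [sg_eq_one, hv k hk, if_neg hki]; norm_num
    have key : ∀ w, (sg e w u = 0 ∨ sg e w u = -1) → ∀ j, sg e x j = 0 →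
        sg e w j = 0 ∨ sg e w j = -1 := by
      intro w hw j hj
      rw [← (hm j).2 hj]
      refine hU.sg_of_zero hxm (fun l hl hl0 => ?_) hj
      rw [(hm l).2 hl0, huU l hl hl0]
      exact hw
    by_cases hvu : sg e v u = 1
    · have := key (-v) (Or.inr (by rw [sg_neg, hvu])) i hxi
      rw [sg_neg, hvi] at this
      exact absurd this (by decide)
    · have := key v (by
        generalize sg e v u = a at *
        clear * - hvu
        revert a
        decide) k hxk
      rw [hvk] at this
      exact absurd this (by decide)
  have hyi := (hxy i).2 hxi
  refine ⟨i, hi, hyi, fun k hk hyk => ?_⟩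
  by_contra hki
  have hmx : sg e m < sg e x := by
    refine lt_of_le_of_ne (fun j => ?_) fun heq => hU.ne_zero i (heq ▸ hxi)
    by_cases h0 : sg e x j = 0
    · rw [(hm j).2 h0]; exact neg_one_le_signType _
    · exact ((hm j).1 h0).le
  obtain ⟨z, hz, hzW⟩ := h.exists_face {i, k}
  have hzx : sg e z < sg e x := by
    refine lt_of_le_of_ne (fun j => ?_) fun heq => ?_
    · by_cases h0 : sg e x j = 0
      · rw [h0]
        refine (h.zero_of_zero hxy.mem_cone hz (fun l hl hl0 => ?_) h0).le
        exact (hzW l hl).1 (Or.inl (hiW l hl hl0))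
      · rw [← (hxy j).1 h0]
        rcases hz j with h1 | h1
        · rw [h.eq_one_of_zero hb hz (fun l hl hl0 => ?_) h1]
          · exact signType_le_one _
          · by_contra hl1
            refine h.ne_zero l (((hzW l hl).2 ?_).symm.trans hl0)
            rintro (rfl | rfl)
            exacts [hl1 hyi, hl1 hyk]
        · exact h1.le
    · exact hki (hiW k hk (heq ▸ (hzW k hk).1 (Or.inr rfl)))
  refine hq.ne (h.sg_eq hxy.mem_cone fun j hj => le_antisymm (hq.le j) ?_)
  by_cases h0 : sg e x j = 0
  · refine le_trans ?_ (hmax z hzx j)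
    rw [h0, (hzW j hj).1 (Or.inl (hiW j hj h0))]
  · rw [← (hm j).1 h0]
    exact hmax m hmx j

end IsSimplicialCone

end FacialWeak

/-- For an essential simplicial arrangement, a face `F` is join-irreducible in the
facial weak order iff `M_F` is join-irreducible in the poset of regions and the
codimension of `F` is `0` or `1`. -/
theorem stmt19 (e : ι → V) (hne : ∀ i, e i ≠ 0) (hess : IsEssential e) (B : Set V)
    (hB : IsRegion e B) (hBpos : ∀ i, B ⊆ posHalf e i)
    (hsimp : IsSimplicial e)
    (F mF MF : Set V) (hF : IsFace e F)
    (hFI : IsFacialInterval e B F mF MF) :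
    (∃! F', IsFace e F' ∧ FWcover e B F' F) ↔
      ((∃! R, IsRegion e R ∧ PRcover e B R MF) ∧
        (fdim F = Module.finrank ℝ V ∨ fdim F + 1 = Module.finrank ℝ V)) := by
  obtain ⟨b, hb0, rfl⟩ := FacialWeak.isRegion_iff.1 hB
  have hb : ∀ i, FacialWeak.sg e b i = -1 := fun i => by
    have h1 : 0 ≤ ⟪e i, b⟫ := hBpos i (FacialWeak.self_mem_cone e b)
    exact FacialWeak.sg_eq_neg_one.2
      (lt_of_le_of_ne h1 fun h0 => hb0 i (FacialWeak.sg_eq_zero.2 h0.symm))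
  obtain ⟨x, rfl⟩ := (FacialWeak.isFace_iff hb).1 hF
  obtain ⟨m, hm⟩ := FacialWeak.exists_down hb x
  obtain ⟨y, hy⟩ := FacialWeak.exists_up hb x
  obtain ⟨-, rfl⟩ := (FacialWeak.isFacialInterval_cone_iff hb hm hy).1 hFI
  have hm0 := fun i => (hm i).1
  have hy0 := fun i => (hy i).1
  have hxy : FacialWeak.IsTop e x y := fun i => (hy i).2
  obtain ⟨W, hW⟩ := FacialWeak.exists_isSimplicialCone hne hy0
    (hsimp _ (FacialWeak.isRegion_iff.2 ⟨y, hy0, rfl⟩))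
  obtain ⟨U, hU⟩ := FacialWeak.exists_isSimplicialCone hne hm0
    (hsimp _ (FacialWeak.isRegion_iff.2 ⟨m, hm0, rfl⟩))
  rw [FacialWeak.existsUnique_FWcover_iff hb, FacialWeak.existsUnique_PRcover_iff hb hy0,
    hW.PR_irreducible_iff hb]
  constructor
  · rintro ⟨q, hq, hmax⟩
    have h := hW.hasUniqueLowerWall_of_FW_irreducible hU hb hxy (fun i => (hm i).2) hq hmax
    exact ⟨h, hW.fdim_of_hasUniqueLowerWall hne hxy h⟩
  · exact fun h => hW.FW_irreducible_of_hasUniqueLowerWall hb hxy h.1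
end
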